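/- Let α₀ be a real quadratic irrational, let G be a finite-index subgroup of Γ = PSL₂(ℤ), let q_G be the smallest integer q > 0 such that the homography z ↦ z + q belongs to G, let γ₀ be a non-trivial element of G fixing α₀ (necessarily hyperbolic, with |tr γ₀| > 2), and let n₀ be the index of the cyclic subgroup generated by γ₀ in the stabilizer in G of the unordered pair {α₀, α₀^σ}. Then, as s → +∞, the number of orbits under translation by q_G ℤ of elements α of G·{α₀, α₀^σ} with h(α) ≤ s is asymptotically equivalent to (12 q_G / (π² [Γ:G] n₀)) · log((|tr γ₀| + √(tr² γ₀ − 4))/2) · s. -/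

import Mathlib

open scoped Real

abbrev SL2Z := Matrix.SpecialLinearGroup (Fin 2) ℤ

/-- The action of `SL(2,ℤ)` (through `PSL(2,ℤ)`) on `ℝ` by Möbius transformations. -/
noncomputable def mobius (g : SL2Z) (x : ℝ) : ℝ :=
  ((g.1 0 0 : ℝ) * x + (g.1 0 1 : ℝ)) / ((g.1 1 0 : ℝ) * x + (g.1 1 1 : ℝ))

/-- The element of `SL(2,ℤ)` inducing the homography `z ↦ z + q`. -/
def transMat (q : ℤ) : SL2Z := ⟨!![1, q; 0, 1], by simp [Matrix.det_fin_two_of]⟩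

section Equidistribution

open MeasureTheory Filter Topology

/-- The Euclidean plane. -/
abbrev Plane := Fin 2 → ℝ

/-- `SL(2,ℤ)` acts on the plane by matrix-vector multiplication. -/
noncomputable instance planeAction : MulAction SL2Z Plane where
  smul g v := Matrix.mulVec (g.1.map (Int.castRingHom ℝ)) v
  one_smul v := by
    change Matrix.mulVec _ v = v
    simp
  mul_smul g h v := by
    change Matrix.mulVec _ v = Matrix.mulVec _ (Matrix.mulVec _ v)
    rw [Matrix.mulVec_mulVec, Matrix.SpecialLinearGroup.coe_mul, Matrix.map_mul]

lemma plane_smul_def (g : SL2Z) (v : Plane) :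
    g • v = Matrix.toLin' (g.1.map (Int.castRingHom ℝ)) v := rfl

lemma plane_smul_zero (g : SL2Z) (v : Plane) :
    (g • v) 0 = g.1 0 0 * v 0 + g.1 0 1 * v 1 := by
  simp [plane_smul_def, Matrix.mulVec, dotProduct, Fin.sum_univ_two]

lemma plane_smul_one (g : SL2Z) (v : Plane) :
    (g • v) 1 = g.1 1 0 * v 0 + g.1 1 1 * v 1 := by
  simp [plane_smul_def, Matrix.mulVec, dotProduct, Fin.sum_univ_two]

lemma sl2z_det (g : SL2Z) : g.1 0 0 * g.1 1 1 - g.1 0 1 * g.1 1 0 = 1 := by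
  have := g.2
  rwa [Matrix.det_fin_two] at this

lemma sl2z_det_real (g : SL2Z) :
    (g.1 0 0 : ℝ) * g.1 1 1 - g.1 0 1 * g.1 1 0 = 1 := by
  exact_mod_cast sl2z_det g

lemma plane_smul_add (g : SL2Z) (v w : Plane) : g • (v + w) = g • v + g • w := by
  simp only [plane_smul_def, map_add]

lemma plane_smul_smul (g : SL2Z) (c : ℝ) (v : Plane) : g • (c • v) = c • (g • v) := by
  simp only [plane_smul_def, map_smul]

lemma plane_continuous_smul (g : SL2Z) : Continuous fun v : Plane => g • v := by
  simp only [plane_smul_def]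
  exact LinearMap.continuous_of_finiteDimensional _

lemma measurePreserving_of_abs_det {E : Type*} [NormedAddCommGroup E] [NormedSpace ℝ E]
    [MeasurableSpace E] [BorelSpace E] [FiniteDimensional ℝ E] (μ : Measure E)
    [μ.IsAddHaarMeasure] (f : E →ₗ[ℝ] E) (hf : |LinearMap.det f| = 1) :
    MeasurePreserving f μ μ := by
  refine ⟨(LinearMap.continuous_of_finiteDimensional f).measurable, ?_⟩
  rw [Measure.map_linearMap_addHaar_eq_smul_addHaar μ (by intro h; simp [h] at hf), abs_inv, hf]
  simp

lemma det_plane (g : SL2Z) :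
    LinearMap.det (Matrix.toLin' (g.1.map (Int.castRingHom ℝ))) = 1 := by
  rw [LinearMap.det_toLin', Matrix.det_fin_two]
  simpa using sl2z_det_real g

instance planeAction_measurable : MeasurableConstSMul SL2Z Plane :=
  ⟨fun g => (plane_continuous_smul g).measurable⟩

instance planeAction_invariant : SMulInvariantMeasure SL2Z Plane volume :=
  ⟨fun g s hs => (measurePreserving_of_abs_det volume
    (Matrix.toLin' (g.1.map (Int.castRingHom ℝ))) (by rw [det_plane]; simp)).measure_preimage
      hs.nullMeasurableSet⟩

instance planePair_isAddHaarMeasure :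
    (volume : Measure (Plane × Plane)).IsAddHaarMeasure :=
  Measure.prod.instIsAddHaarMeasure _ _

lemma planePair_measurePreserving (g : SL2Z) :
    MeasurePreserving (fun x : Plane × Plane => g • x) volume volume :=
  (measurePreserving_smul g (volume : Measure Plane)).prod
    (measurePreserving_smul g (volume : Measure Plane))

instance planePair_measurable : MeasurableConstSMul SL2Z (Plane × Plane) :=
  ⟨fun g => (planePair_measurePreserving g).measurable⟩

/-- The determinant of a pair of vectors of the plane. -/
def pairDet (x : Plane × Plane) : ℝ := x.1 0 * x.2 1 - x.1 1 * x.2 0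

lemma pairDet_smul (g : SL2Z) (x : Plane × Plane) : pairDet (g • x) = pairDet x := by
  simp only [pairDet, Prod.smul_fst, Prod.smul_snd, plane_smul_zero, plane_smul_one]
  linear_combination (x.1 0 * x.2 1 - x.1 1 * x.2 0) * sl2z_det_real g

/-- The pairs of vectors whose determinant lies in `(0, 1)`. -/
def unitPairs : Set (Plane × Plane) := {x | pairDet x ∈ Set.Ioo 0 1}

lemma continuous_pairDet : Continuous pairDet := by
  unfold pairDet
  fun_prop

lemma isOpen_unitPairs : IsOpen unitPairs := isOpen_Ioo.preimage continuous_pairDet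

lemma restrict_unitPairs_preserving {f : Plane × Plane → Plane × Plane}
    (hf : MeasurePreserving f volume volume) (hdet : ∀ x, pairDet (f x) = pairDet x) :
    MeasurePreserving f (volume.restrict unitPairs) (volume.restrict unitPairs) := by
  have h := hf.restrict_preimage isOpen_unitPairs.measurableSet
  rwa [show f ⁻¹' unitPairs = unitPairs by ext x; simp [unitPairs, hdet]] at h

instance planePair_invariant :
    SMulInvariantMeasure SL2Z (Plane × Plane) (volume.restrict unitPairs) :=
  ⟨fun g _ hs => (restrict_unitPairs_preserving (planePair_measurePreserving g)
    (pairDet_smul g)).measure_preimage hs.nullMeasurableSet⟩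

lemma plane_null {N : Set Plane} (hN : MeasurableSet N)
    (h : ∀ᵐ y : ℝ, {t : ℝ | ![y, t] ∈ N}.Countable) : volume N = 0 := by
  have hp := (volume_preserving_finTwoArrow ℝ).symm
  rw [← hp.measure_preimage hN.nullMeasurableSet]
  have hm : MeasurableSet ((MeasurableEquiv.finTwoArrow (α := ℝ)).symm ⁻¹' N) := hp.measurable hN
  rw [Measure.volume_eq_prod, Measure.measure_prod_null hm]
  filter_upwards [h] with y hy
  exact hy.measure_zero _

lemma quadratic_countable (p r : ℝ) : {t : ℝ | t ^ 2 + p * t + r = 0}.Countable := by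
  by_cases h : ∃ t₀ : ℝ, t₀ ^ 2 + p * t₀ + r = 0
  · obtain ⟨t₀, h₀⟩ := h
    refine ((Set.finite_singleton (-p - t₀)).insert t₀).countable.mono fun t ht => ?_
    have ht : t ^ 2 + p * t + r = 0 := ht
    have : (t - t₀) * (t - (-p - t₀)) = 0 := by linear_combination ht - h₀
    rcases mul_eq_zero.1 this with h | h
    · exact Or.inl (sub_eq_zero.1 h)
    · exact Or.inr (sub_eq_zero.1 h)
  · push Not at h
    convert Set.countable_empty
    ext t
    simpa using h t

/-- Transposition of the `2 × 2` matrix whose columns are the given pair. -/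
def transposePair : (Plane × Plane) →ₗ[ℝ] (Plane × Plane) where
  toFun x := (![x.1 0, x.2 0], ![x.1 1, x.2 1])
  map_add' x y := by ext i <;> fin_cases i <;> simp
  map_smul' c x := by ext i <;> fin_cases i <;> simp

lemma transposePair_preserving : MeasurePreserving transposePair volume volume := by
  refine measurePreserving_of_abs_det volume _ ?_
  have h : transposePair * transposePair = 1 := by
    ext x i <;> fin_cases i <;> simp [transposePair]
  have h2 : LinearMap.det transposePair * LinearMap.det transposePair = 1 := by
    rw [← map_mul, h, map_one]
  rw [← sq_eq_sq₀ (abs_nonneg _) zero_le_one, sq_abs, sq, h2, one_pow]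

/-- Squared length of the first row of a pair of columns. -/
def rowTop (x : Plane × Plane) : ℝ := x.1 0 ^ 2 + x.2 0 ^ 2

/-- Squared length of the second row of a pair of columns. -/
def rowBot (x : Plane × Plane) : ℝ := x.1 1 ^ 2 + x.2 1 ^ 2

/-- Inner product of the rows of a pair of columns. -/
def rowDot (x : Plane × Plane) : ℝ := x.1 0 * x.1 1 + x.2 0 * x.2 1

/-- Gauss-reduced pairs: a fundamental domain of `SL(2,ℤ)` in `unitPairs`. -/
def gaussDomain : Set (Plane × Plane) :=
  {x | pairDet x ∈ Set.Ioo 0 1 ∧ |2 * rowDot x| < rowBot x ∧ rowBot x < rowTop x ∧ 0 < x.1 1}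

lemma rows_null {N : Set (Plane × Plane)} (hN : MeasurableSet N)
    (h : ∀ u : Plane, ∀ᵐ y : ℝ, {t : ℝ | (![u 0, y], ![u 1, t]) ∈ N}.Countable) :
    volume N = 0 := by
  rw [← transposePair_preserving.measure_preimage hN.nullMeasurableSet]
  have hm : MeasurableSet (transposePair ⁻¹' N) := transposePair_preserving.measurable hN
  rw [Measure.volume_eq_prod, Measure.measure_prod_null hm]
  refine Eventually.of_forall fun u => plane_null (measurable_prodMk_left hm) ?_
  filter_upwards [h u] with y hy
  simpa [transposePair] using hy

/-- The pairs which are on the boundary of the Gauss domain, or have a zero entry. -/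
def gaussBoundary : Set (Plane × Plane) :=
  {x | 2 * rowDot x = rowBot x ∨ 2 * rowDot x = -rowBot x ∨ rowBot x = rowTop x ∨ x.1 1 = 0}

lemma gaussBoundary_null : volume gaussBoundary = 0 := by
  refine rows_null ?_ fun u => ?_
  · have h1 : Continuous rowTop := by unfold rowTop; fun_prop
    have h2 : Continuous rowBot := by unfold rowBot; fun_prop
    have h3 : Continuous rowDot := by unfold rowDot; fun_prop
    have h4 : Continuous fun x : Plane × Plane => x.1 1 := by fun_prop
    exact (isClosed_eq (h3.const_mul 2) h2).measurableSet.union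
      ((isClosed_eq (h3.const_mul 2) h2.neg).measurableSet.union
      ((isClosed_eq h2 h1).measurableSet.union (isClosed_eq h4 continuous_const).measurableSet))
  · have h0 : ∀ᵐ y : ℝ, y ≠ 0 := by simp [ae_iff]
    filter_upwards [h0] with y hy
    refine ((quadratic_countable (-2 * u 1) (y ^ 2 - 2 * u 0 * y)).union
      ((quadratic_countable (2 * u 1) (y ^ 2 + 2 * u 0 * y)).union
      (quadratic_countable 0 (y ^ 2 - u 0 ^ 2 - u 1 ^ 2)))).mono fun t ht => ?_
    simp only [gaussBoundary, rowDot, rowBot, rowTop, Set.mem_ofPred_eq, Matrix.cons_val_zero,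
      Matrix.cons_val_one] at ht
    rcases ht with h | h | h | h
    · left; simp only [Set.mem_ofPred_eq]; linarith
    · right; left; simp only [Set.mem_ofPred_eq]; linarith
    · right; right; simp only [Set.mem_ofPred_eq]; linarith
    · exact absurd h hy

lemma isOpen_gaussDomain : IsOpen gaussDomain := by
  have h1 : Continuous rowTop := by unfold rowTop; fun_prop
  have h2 : Continuous rowBot := by unfold rowBot; fun_prop
  have h3 : Continuous rowDot := by unfold rowDot; fun_prop
  have h4 : Continuous fun x : Plane × Plane => x.1 1 := by fun_prop
  exact isOpen_unitPairs.inter ((isOpen_lt (h3.const_mul 2).abs h2).inter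
    ((isOpen_lt h2 h1).inter (isOpen_lt continuous_const h4)))

lemma gaussDomain_subset : gaussDomain ⊆ unitPairs := fun _ hx => hx.1

lemma gaussDomain_volume_lt_top : volume gaussDomain < ⊤ := by
  let E : Set (Plane × Plane) := {y |
    |2 * (y.1 0 * y.2 0 + y.1 1 * y.2 1)| ≤ y.2 0 ^ 2 + y.2 1 ^ 2 ∧
    0 ≤ y.1 0 * y.2 1 - y.2 0 * y.1 1 ∧ y.1 0 * y.2 1 - y.2 0 * y.1 1 ≤ 1 ∧
    y.2 0 ^ 2 + y.2 1 ^ 2 ≤ 2 ∧ y.2 0 ≠ 0}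
  have hE : MeasurableSet E := by
    have hc : ∀ {f g : Plane × Plane → ℝ}, Continuous f → Continuous g →
        MeasurableSet {y | f y ≤ g y} := fun hf hg => (isClosed_le hf hg).measurableSet
    have m1 : Continuous fun y : Plane × Plane => |2 * (y.1 0 * y.2 0 + y.1 1 * y.2 1)| := by
      fun_prop
    have m2 : Continuous fun y : Plane × Plane => y.2 0 ^ 2 + y.2 1 ^ 2 := by fun_prop
    have m3 : Continuous fun y : Plane × Plane => y.1 0 * y.2 1 - y.2 0 * y.1 1 := by fun_prop
    have m4 : Continuous fun y : Plane × Plane => y.2 0 := by fun_prop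
    exact (hc m1 m2).inter ((hc continuous_const m3).inter ((hc m3 continuous_const).inter
      ((hc m2 continuous_const).inter
        (isClosed_eq m4 continuous_const).measurableSet.compl)))
  have hsub : gaussDomain ⊆ transposePair ⁻¹' E := by
    rintro x ⟨⟨h0, h1⟩, h2, h3, h4⟩
    have key : rowTop x * rowBot x = rowDot x ^ 2 + pairDet x ^ 2 := by
      simp only [rowTop, rowBot, rowDot, pairDet]; ring
    have hB : 0 < rowBot x := lt_of_le_of_lt (abs_nonneg _) h2
    have h5 : (2 * rowDot x) ^ 2 < rowBot x ^ 2 := by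
      rw [← sq_abs]; exact pow_lt_pow_left₀ h2 (abs_nonneg _) two_ne_zero
    have h6 : pairDet x ^ 2 < 1 := by nlinarith
    have h7 : rowBot x < 2 := by nlinarith
    simp only [rowDot, rowBot, pairDet] at h0 h1 h2 h7
    simp only [E, transposePair, Set.mem_preimage, Set.mem_ofPred_eq, LinearMap.coe_mk,
      AddHom.coe_mk, Matrix.cons_val_zero, Matrix.cons_val_one]
    refine ⟨?_, ?_, ?_, h7.le, h4.ne'⟩
    · refine le_trans (le_of_eq ?_) h2.le
      congr 1
    · linarith
    · linarith
  refine lt_of_le_of_lt (measure_mono hsub) ?_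
  rw [transposePair_preserving.measure_preimage hE.nullMeasurableSet, Measure.volume_eq_prod,
    Measure.prod_apply_symm hE]
  have hslice : ∀ y : Plane, volume ((fun x => (x, y)) ⁻¹' E) ≤
      (Metric.closedBall (0 : Plane) 2).indicator 1 y := by
    intro y
    by_cases hy : y ∈ Metric.closedBall (0 : Plane) 2
    · rw [Set.indicator_of_mem hy]
      by_cases hy0 : y 0 = 0
      · have : (fun x : Plane => (x, y)) ⁻¹' E = ∅ := by
          ext x; simp [E, hy0]
        simp [this]
      set Q := y 0 ^ 2 + y 1 ^ 2 with hQ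
      have hQ0 : 0 < Q := by positivity
      let f : Plane →ₗ[ℝ] Plane := Matrix.toLin' !![y 0, y 1; y 1, -y 0]
      have hdet : LinearMap.det f = -Q := by
        simp only [f, LinearMap.det_toLin', Matrix.det_fin_two_of, hQ]; ring
      have hsub : (fun x : Plane => (x, y)) ⁻¹' E ⊆ f ⁻¹' Set.Icc ![-Q / 2, 0] ![Q / 2, 1] := by
        rintro x ⟨h1, h2, h3, -, -⟩
        rw [abs_le] at h1
        simp only [Set.mem_preimage, Set.mem_Icc, Pi.le_def, Fin.forall_fin_two, f]
        simp only [Matrix.toLin'_apply, Matrix.mulVec, dotProduct, Fin.sum_univ_two,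
          Matrix.of_apply, Matrix.cons_val_zero, Matrix.cons_val_one]
        simp only at h1 h2 h3
        refine ⟨⟨?_, ?_⟩, ?_, ?_⟩ <;> linarith [h1.1, h1.2]
      refine (measure_mono hsub).trans ?_
      rw [Measure.addHaar_preimage_linearMap _ (by rw [hdet]; linarith), hdet, Real.volume_Icc_pi]
      simp only [Fin.prod_univ_two, Matrix.cons_val_zero, Matrix.cons_val_one]
      rw [← ENNReal.ofReal_mul (by linarith), ← ENNReal.ofReal_mul (by positivity),
        abs_inv, abs_neg, abs_of_pos hQ0]
      simp only [Pi.one_apply]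
      rw [show Q⁻¹ * ((Q / 2 - -Q / 2) * (1 - 0)) = 1 by field_simp; ring]
      simp
    · rw [Set.indicator_of_notMem hy, nonpos_iff_eq_zero]
      convert measure_empty (μ := (volume : Measure Plane))
      ext x
      simp only [Set.mem_preimage, Set.mem_empty_iff_false, iff_false]
      rintro ⟨-, -, -, h, -⟩
      apply hy
      simp only at h
      rw [mem_closedBall_zero_iff, pi_norm_le_iff_of_nonneg (by norm_num)]
      intro i
      rw [Real.norm_eq_abs]
      apply abs_le_of_sq_le_sq _ (by norm_num)
      fin_cases i <;> simp <;> nlinarith [sq_nonneg (y 0), sq_nonneg (y 1)]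
  refine lt_of_le_of_lt (lintegral_mono hslice) ?_
  rw [lintegral_indicator_one Metric.isClosed_closedBall.measurableSet]
  exact measure_closedBall_lt_top

instance countable_sl2z : Countable SL2Z :=
  Function.Injective.countable (β := Fin 2 → Fin 2 → ℤ) (f := fun g => g.1)
    Subtype.val_injective

lemma rowBot_smul (g : SL2Z) (x : Plane × Plane) : rowBot (g • x) =
    g.1 1 0 ^ 2 * rowTop x + g.1 1 0 * g.1 1 1 * (2 * rowDot x) + g.1 1 1 ^ 2 * rowBot x := by
  simp only [rowTop, rowBot, rowDot, Prod.smul_fst, Prod.smul_snd, plane_smul_one]; ring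

lemma rowDot_smul (g : SL2Z) (x : Plane × Plane) : rowDot (g • x) =
    g.1 0 0 * g.1 1 0 * rowTop x + (g.1 0 0 * g.1 1 1 + g.1 0 1 * g.1 1 0) * rowDot x
      + g.1 0 1 * g.1 1 1 * rowBot x := by
  simp only [rowTop, rowBot, rowDot, Prod.smul_fst, Prod.smul_snd, plane_smul_zero,
    plane_smul_one]; ring

lemma rowBot_lt_of_ne_zero {g : SL2Z} {x : Plane × Plane} (hx : x ∈ gaussDomain)
    (hg : g.1 1 0 ≠ 0) : rowBot x < rowBot (g • x) := by
  obtain ⟨-, h1, h2, -⟩ := hx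
  rw [rowBot_smul]
  generalize g.1 1 0 = c at *
  generalize g.1 1 1 = d at *
  have hQ : 0 < rowBot x := lt_of_le_of_lt (abs_nonneg _) h1
  have hc : 0 < (c : ℝ) ^ 2 := by positivity
  have hcd : (1 : ℝ) ≤ c ^ 2 - |(c : ℝ) * d| + d ^ 2 := by
    have : (1 : ℤ) ≤ c ^ 2 - |c * d| + d ^ 2 := by
      have h3 : 0 < 2 * (c ^ 2 - |c * d| + d ^ 2) := by
        have hc : 0 < c ^ 2 := by positivity
        have : |c * d| = |c| * |d| := abs_mul c d
        nlinarith [sq_nonneg (|c| - |d|), sq_abs c, sq_abs d, sq_nonneg d]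
      omega
    exact_mod_cast this
  have h3 : -(|(c : ℝ) * d| * rowBot x) ≤ c * d * (2 * rowDot x) := by
    have : |(c : ℝ) * d * (2 * rowDot x)| ≤ |(c : ℝ) * d| * rowBot x := by
      rw [abs_mul]; gcongr
    linarith [neg_abs_le ((c : ℝ) * d * (2 * rowDot x))]
  nlinarith

lemma eq_one_of_mem_gaussDomain {g : SL2Z} {x : Plane × Plane} (hx : x ∈ gaussDomain)
    (hgx : g • x ∈ gaussDomain) : g = 1 := by
  have hc : g.1 1 0 = 0 := by
    by_contra hc
    have h1 := rowBot_lt_of_ne_zero hx hc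
    have h2 : rowBot (g • x) < rowBot (g⁻¹ • g • x) := rowBot_lt_of_ne_zero hgx (by
      rw [Matrix.SpecialLinearGroup.SL2_inv_expl]
      simpa using hc)
    rw [inv_smul_smul] at h2
    exact lt_asymm h1 h2
  have hdet := sl2z_det g
  have hpos := hgx.2.2.2
  rw [Prod.smul_fst, plane_smul_one, hc] at hpos
  rw [hc] at hdet
  have hd : 0 < g.1 1 1 := by
    have : (0 : ℝ) < g.1 1 1 := by
      have h4 := hx.2.2.2
      simp only [Int.cast_zero, zero_mul, zero_add] at hpos
      exact pos_of_mul_pos_left hpos h4.le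
    exact_mod_cast this
  have had : g.1 0 0 * g.1 1 1 = 1 := by linarith
  have hd1 : g.1 1 1 = 1 := by
    rcases Int.mul_eq_one_iff_eq_one_or_neg_one.1 had with h | h <;> omega
  have ha1 : g.1 0 0 = 1 := by simpa [hd1] using had
  have h1 := hx.2.1
  have h2 := hgx.2.1
  rw [rowBot_smul, rowDot_smul, hc, hd1, ha1] at h2
  simp only [Int.cast_zero, Int.cast_one] at h2
  have hQ : 0 < rowBot x := lt_of_le_of_lt (abs_nonneg _) h1
  rw [abs_lt] at h1 h2
  have hb : g.1 0 1 = 0 := by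
    have h3 : (-1 : ℝ) < g.1 0 1 := by nlinarith [h1.2, h2.1]
    have h4 : (g.1 0 1 : ℝ) < 1 := by nlinarith [h1.1, h2.2]
    have h3 : -1 < g.1 0 1 := by exact_mod_cast h3
    have h4 : g.1 0 1 < 1 := by exact_mod_cast h4
    omega
  ext i j
  fin_cases i <;> fin_cases j <;> simp [hc, hd1, ha1, hb]

lemma exists_smul_reduced {x : Plane × Plane} (hx : x ∈ unitPairs) :
    ∃ g : SL2Z, |2 * rowDot (g • x)| ≤ rowBot (g • x) ∧ rowBot (g • x) ≤ rowTop (g • x) := by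
  have hdet := hx.1
  have key : rowTop x * rowBot x = rowDot x ^ 2 + pairDet x ^ 2 := by
    simp only [rowTop, rowBot, rowDot, pairDet]; ring
  have hQ : 0 < rowBot x := by
    have h0 : 0 ≤ rowBot x := by unfold rowBot; positivity
    rcases h0.lt_or_eq with h | h
    · exact h
    · rw [← h] at key; nlinarith [sq_nonneg (rowDot x)]
  have him : 0 < ((⟨rowDot x / rowBot x, pairDet x / rowBot x⟩ : ℂ)).im := by
    simp only; positivity
  obtain ⟨g, hg1, hg2⟩ := ModularGroup.exists_smul_mem_fd ⟨_, him⟩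
  refine ⟨g, ?_⟩
  have hgx : pairDet (g • x) = pairDet x := pairDet_smul g x
  have key' : rowTop (g • x) * rowBot (g • x) = rowDot (g • x) ^ 2 + pairDet (g • x) ^ 2 := by
    simp only [rowTop, rowBot, rowDot, pairDet]; ring
  have hQ' : 0 < rowBot (g • x) := by
    have h0 : 0 ≤ rowBot (g • x) := by unfold rowBot; positivity
    rcases h0.lt_or_eq with h | h
    · exact h
    · rw [← h, hgx] at key'; nlinarith [sq_nonneg (rowDot (g • x))]
  have hz : (((g • (⟨⟨rowDot x / rowBot x, pairDet x / rowBot x⟩, him⟩ : UpperHalfPlane)) :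
      UpperHalfPlane) : ℂ) =
      ⟨rowDot (g • x) / rowBot (g • x), pairDet x / rowBot (g • x)⟩ := by
    have hw : ∀ y : Plane × Plane, 0 < rowBot y →
        (⟨rowDot y / rowBot y, pairDet y / rowBot y⟩ : ℂ) =
        (⟨y.2 0, y.1 0⟩ : ℂ) / ⟨y.2 1, y.1 1⟩ := by
      intro y hy
      have hne : (⟨y.2 1, y.1 1⟩ : ℂ) ≠ 0 := by
        intro h
        rw [Complex.ext_iff] at h
        simp only [Complex.zero_re, Complex.zero_im] at h
        simp [rowBot, h.1, h.2] at hy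
      rw [eq_div_iff hne]
      have hy' := hy.ne'
      apply Complex.ext
      · simp only [Complex.mul_re]
        field_simp
        simp only [rowDot, rowBot, pairDet]; ring
      · simp only [Complex.mul_im]
        field_simp
        simp only [rowDot, rowBot, pairDet]; ring
    rw [UpperHalfPlane.coe_specialLinearGroup_apply]
    have h1 : (((⟨⟨rowDot x / rowBot x, pairDet x / rowBot x⟩, him⟩ : UpperHalfPlane)) : ℂ) =
      (⟨x.2 0, x.1 0⟩ : ℂ) / ⟨x.2 1, x.1 1⟩ := hw x hQ
    rw [h1, ← hgx, hw _ hQ']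
    have hne : (⟨x.2 1, x.1 1⟩ : ℂ) ≠ 0 := by
      intro h
      rw [Complex.ext_iff] at h
      simp only [Complex.zero_re, Complex.zero_im] at h
      simp [rowBot, h.1, h.2] at hQ
    have e0 : (⟨(g • x).2 0, (g • x).1 0⟩ : ℂ) =
        (g.1 0 0 : ℂ) * ⟨x.2 0, x.1 0⟩ + (g.1 0 1 : ℂ) * ⟨x.2 1, x.1 1⟩ := by
      apply Complex.ext <;>
        simp [Prod.smul_fst, Prod.smul_snd, plane_smul_zero, Complex.mul_re, Complex.mul_im]
    have e1 : (⟨(g • x).2 1, (g • x).1 1⟩ : ℂ) =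
        (g.1 1 0 : ℂ) * ⟨x.2 0, x.1 0⟩ + (g.1 1 1 : ℂ) * ⟨x.2 1, x.1 1⟩ := by
      apply Complex.ext <;>
        simp [Prod.smul_fst, Prod.smul_snd, plane_smul_one, Complex.mul_re, Complex.mul_im]
    rw [e0, e1]
    simp only [algebraMap_int_eq, eq_intCast, Complex.ofReal_intCast]
    rw [← mul_div_assoc, div_add' _ _ _ hne, ← mul_div_assoc, div_add' _ _ _ hne,
      div_div_div_cancel_right₀ hne]
  rw [← UpperHalfPlane.coe_re, hz] at hg2
  rw [hz] at hg1
  simp only [Complex.normSq_mk] at hg1 hg2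
  rw [abs_div, abs_of_pos hQ', div_le_iff₀ hQ'] at hg2
  refine ⟨by rw [abs_mul]; norm_num; linarith, ?_⟩
  rw [← hgx] at hg1
  have h5 : rowDot (g • x) / rowBot (g • x) * (rowDot (g • x) / rowBot (g • x)) +
      pairDet (g • x) / rowBot (g • x) * (pairDet (g • x) / rowBot (g • x)) =
      rowTop (g • x) / rowBot (g • x) := by
    field_simp
    linarith
  rw [h5, le_div_iff₀ hQ'] at hg1
  linarith

lemma plane_neg_smul (g : SL2Z) (v : Plane) : (-g) • v = -(g • v) := by
  ext i; fin_cases i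
  · simp [plane_smul_zero]; ring
  · simp [plane_smul_one]; ring

lemma gaussDomain_isFundamentalDomain :
    IsFundamentalDomain SL2Z gaussDomain (volume.restrict unitPairs) := by
  refine IsFundamentalDomain.mk'' isOpen_gaussDomain.measurableSet.nullMeasurableSet ?_ ?_
    fun g => (measurePreserving_smul g _).quasiMeasurePreserving
  · have hnull : ∀ᵐ x ∂(volume : Measure (Plane × Plane)), ∀ g : SL2Z, g • x ∉ gaussBoundary := by
      rw [ae_all_iff]
      intro g
      have h := (planePair_measurePreserving g).quasiMeasurePreserving.preimage_null
        gaussBoundary_null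
      rw [ae_iff]
      simpa using! h
    rw [ae_restrict_iff' isOpen_unitPairs.measurableSet]
    filter_upwards [hnull] with x hx hmem
    obtain ⟨g, h1, h2⟩ := exists_smul_reduced hmem
    have hb := hx g
    simp only [gaussBoundary, Set.mem_ofPred_eq, not_or] at hb
    obtain ⟨b1, b2, b3, b4⟩ := hb
    have hdet : pairDet (g • x) ∈ Set.Ioo 0 1 := by rw [pairDet_smul]; exact hmem
    have h1' : |2 * rowDot (g • x)| < rowBot (g • x) := by
      refine lt_of_le_of_ne h1 fun h => ?_
      rcases abs_choice (2 * rowDot (g • x)) with h' | h' <;> rw [h'] at h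
      · exact b1 h
      · exact b2 (by linarith)
    rcases lt_or_gt_of_ne b4 with h | h
    · refine ⟨-g, ?_⟩
      have e : (-g) • x = -(g • x) := Prod.ext (plane_neg_smul g _) (plane_neg_smul g _)
      rw [e]
      have e1 : pairDet (-(g • x)) = pairDet (g • x) := by simp [pairDet]
      have e2 : rowDot (-(g • x)) = rowDot (g • x) := by simp [rowDot]
      have e3 : rowBot (-(g • x)) = rowBot (g • x) := by simp [rowBot]
      have e4 : rowTop (-(g • x)) = rowTop (g • x) := by simp [rowTop]
      refine ⟨by rwa [e1], by rwa [e2, e3], ?_, by simpa using h⟩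
      rw [e3, e4]; exact lt_of_le_of_ne h2 b3
    · exact ⟨g, hdet, h1', lt_of_le_of_ne h2 b3, h⟩
  · intro g hg
    refine Disjoint.aedisjoint (Set.disjoint_left.2 ?_)
    rintro _ ⟨x, hx, rfl⟩ hgx
    exact hg (eq_one_of_mem_gaussDomain hx hgx)

lemma tendsto_integral_norm_comp_sub {X : Type*} [TopologicalSpace X] [MeasurableSpace X]
    [BorelSpace X] [R1Space X] {μ : Measure X} [μ.InnerRegularCompactLTTop]
    [IsLocallyFiniteMeasure μ] {k : X → ℝ} (hk : Integrable k μ) (S : ℝ → C(X, X))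
    (hS : Continuous S) (hm : ∀ t, MeasurePreserving (S t) μ μ) :
    Tendsto (fun t => ∫ x, ‖k (S t x) - k (S 0 x)‖ ∂μ) (𝓝 0) (𝓝 0) := by
  have h1 : Tendsto (fun t => Lp.compMeasurePreserving (S t) (hm t) (hk.toL1 k)) (𝓝 0)
      (𝓝 (Lp.compMeasurePreserving (S 0) (hm 0) (hk.toL1 k))) :=
    Filter.Tendsto.compMeasurePreservingLp tendsto_const_nhds (hS.tendsto 0) hm (hm 0)
      ENNReal.one_ne_top
  rw [tendsto_iff_norm_sub_tendsto_zero] at h1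
  refine h1.congr fun t => ?_
  rw [L1.norm_eq_integral_norm]
  refine integral_congr_ae ?_
  have hc : ∀ s, (Lp.compMeasurePreserving (S s) (hm s) (hk.toL1 k) : X → ℝ) =ᵐ[μ]
      fun x => k (S s x) := fun s =>
    (Lp.coeFn_compMeasurePreserving _ (hm s)).trans
      ((hm s).quasiMeasurePreserving.ae_eq hk.coeFn_toL1)
  filter_upwards [Lp.coeFn_sub (Lp.compMeasurePreserving (S t) (hm t) (hk.toL1 k))
    (Lp.compMeasurePreserving (S 0) (hm 0) (hk.toL1 k)), hc t, hc 0] with x h1 h2 h3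
  rw [h1, Pi.sub_apply, h2, h3]

/-- The linear combination of a pair of vectors with the given coefficients. -/
def comb (p : Plane) (x : Plane × Plane) : Plane := p 0 • x.1 + p 1 • x.2

lemma continuous_comb (p : Plane) : Continuous (comb p) := by unfold comb; fun_prop

lemma comb_smul (p : Plane) (g : SL2Z) (x : Plane × Plane) : comb p (g • x) = g • comb p x := by
  simp [comb, plane_smul_add, plane_smul_smul]

/-- Right multiplication of the matrix with columns `x.1, x.2` by a `2 × 2` matrix. -/
def mix (p q r s : ℝ) (x : Plane × Plane) : Plane × Plane := (comb ![p, q] x, comb ![r, s] x)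

lemma mix_preserving {p q r s : ℝ} (h : p * s - q * r = 1) :
    MeasurePreserving (mix p q r s) volume volume := by
  have hA : MeasurePreserving (Matrix.toLin' !![p, q; r, s]) (volume : Measure Plane) volume :=
    measurePreserving_of_abs_det _ _ (by
      rw [LinearMap.det_toLin', Matrix.det_fin_two_of, h, abs_one])
  have h2 := (transposePair_preserving.comp (hA.prod hA)).comp transposePair_preserving
  convert! h2 using 1
  ext x i
  · fin_cases i <;> simp [mix, comb, transposePair] <;> ring
  · fin_cases i <;> simp [mix, comb, transposePair] <;> ring

lemma pairDet_mix {p q r s : ℝ} (h : p * s - q * r = 1) (x : Plane × Plane) :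
    pairDet (mix p q r s x) = pairDet x := by
  simp only [pairDet, mix, comb, Matrix.cons_val_zero, Matrix.cons_val_one, Pi.add_apply,
    Pi.smul_apply, smul_eq_mul]
  linear_combination (x.1 0 * x.2 1 - x.1 1 * x.2 0) * h

lemma mix_smul (p q r s : ℝ) (g : SL2Z) (x : Plane × Plane) :
    mix p q r s (g • x) = g • mix p q r s x := by
  simp only [mix, comb_smul]; rfl

lemma continuous_mix (p q r s : ℝ) : Continuous (mix p q r s) :=
  (continuous_comb _).prodMk (continuous_comb _)

lemma mix_measurableEmbedding {p q r s : ℝ} (h : p * s - q * r = 1) :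
    MeasurableEmbedding (mix p q r s) := by
  refine (continuous_mix p q r s).measurable.measurableEmbedding ?_
  refine Function.LeftInverse.injective (g := mix s (-q) (-r) p) fun x => ?_
  ext i
  · simp only [mix, comb, Matrix.cons_val_zero, Matrix.cons_val_one, Pi.add_apply,
      Pi.smul_apply, smul_eq_mul]
    linear_combination x.1 i * h
  · simp only [mix, comb, Matrix.cons_val_zero, Matrix.cons_val_one, Pi.add_apply,
      Pi.smul_apply, smul_eq_mul]
    linear_combination x.2 i * h

lemma restrict_gaussDomain : (volume.restrict unitPairs).restrict gaussDomain =
    (volume : Measure (Plane × Plane)).restrict gaussDomain :=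
  Measure.restrict_restrict_of_subset gaussDomain_subset

lemma integral_gaussDomain_mix {p q r s : ℝ} (h : p * s - q * r = 1) {Ψ : Plane × Plane → ℝ}
    (hΨ : ∀ (g : SL2Z) x, Ψ (g • x) = Ψ x) :
    ∫ x in gaussDomain, Ψ (mix p q r s x) = ∫ x in gaussDomain, Ψ x := by
  have hp := restrict_unitPairs_preserving (mix_preserving h) (pairDet_mix h)
  have hD : IsFundamentalDomain SL2Z (mix p q r s ⁻¹' gaussDomain) (volume.restrict unitPairs) :=
    gaussDomain_isFundamentalDomain.preimage_of_equiv hp.quasiMeasurePreserving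
      Function.bijective_id fun g x => mix_smul p q r s g x
  rw [← restrict_gaussDomain, gaussDomain_isFundamentalDomain.setIntegral_eq hD
    (f := fun x => Ψ (mix p q r s x)) (fun g x => by rw [mix_smul, hΨ]),
    hp.setIntegral_preimage_emb (mix_measurableEmbedding h)]

lemma comb_mix (c : Plane) (p q r s : ℝ) (x : Plane × Plane) :
    comb c (mix p q r s x) = comb ![c 0 * p + c 1 * r, c 0 * q + c 1 * s] x := by
  ext i
  simp [comb, mix]; ring

instance gaussDomain_finite :
    IsFiniteMeasure ((volume : Measure (Plane × Plane)).restrict gaussDomain) :=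
  ⟨by rw [Measure.restrict_apply_univ]; exact gaussDomain_volume_lt_top⟩

section Correlation

variable {ι : Type*}

/-- The correlation of `F` along the vectors `p` and `q`. -/
noncomputable def corr [Fintype ι] (F : ι → Plane → ℝ) (p q : Plane) : ℝ :=
  ∫ x in gaussDomain, ∑ i, F i (comb p x) * F i (comb q x)

lemma corr_comm [Fintype ι] (F : ι → Plane → ℝ) (p q : Plane) : corr F p q = corr F q p := by
  simp only [corr, mul_comm]

lemma corr_mix [Fintype ι] [MulAction SL2Z ι] {F : ι → Plane → ℝ}
    (hF : ∀ (g : SL2Z) i v, F (g • i) (g • v) = F i v)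
    {p q r s : ℝ} (h : p * s - q * r = 1) (c d : Plane) :
    corr F ![c 0 * p + c 1 * r, c 0 * q + c 1 * s] ![d 0 * p + d 1 * r, d 0 * q + d 1 * s] =
      corr F c d := by
  rw [corr, corr, ← integral_gaussDomain_mix h (Ψ := fun x => ∑ i, F i (comb c x) * F i (comb d x))]
  · simp only [comb_mix]
  · intro g x
    simp only [comb_smul]
    rw [← Equiv.sum_comp (MulAction.toPerm g)]
    simp only [MulAction.toPerm_apply, hF]

lemma integrable_corr {F : ι → Plane → ℝ} (hm : ∀ i, Measurable (F i))
    (hb : ∀ i v, |F i v| ≤ 1) (i : ι) (p q : Plane) :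
    Integrable (fun x => F i (comb p x) * F i (comb q x)) (volume.restrict gaussDomain) := by
  refine Integrable.of_bound (C := 1)
    (((hm i).comp (continuous_comb p).measurable).mul
      ((hm i).comp (continuous_comb q).measurable)).aestronglyMeasurable
    (Eventually.of_forall fun x => ?_)
  rw [Real.norm_eq_abs, abs_mul]
  exact mul_le_one₀ (hb _ _) (abs_nonneg _) (hb _ _)

lemma ae_eq_of_corr [Fintype ι] {F : ι → Plane → ℝ} (hm : ∀ i, Measurable (F i))
    (hb : ∀ i v, |F i v| ≤ 1) {p q : Plane} {L : ℝ} (hp : corr F p p = L) (hq : corr F q q = L)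
    (hpq : corr F p q = L) :
    ∀ᵐ x ∂(volume.restrict gaussDomain), ∀ i, F i (comb p x) = F i (comb q x) := by
  have hI := fun i p q => integrable_corr hm hb i p q
  have hIs := fun p q => integrable_finsetSum (Finset.univ : Finset ι) fun i _ => hI i p q
  have h0 : ∫ x in gaussDomain, ∑ i, (F i (comb p x) - F i (comb q x)) ^ 2 = 0 := by
    have : ∀ x, ∑ i, (F i (comb p x) - F i (comb q x)) ^ 2 =
        (∑ i, F i (comb p x) * F i (comb p x)) - 2 * (∑ i, F i (comb p x) * F i (comb q x)) +
          ∑ i, F i (comb q x) * F i (comb q x) := by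
      intro x
      rw [Finset.mul_sum, ← Finset.sum_sub_distrib, ← Finset.sum_add_distrib]
      exact Finset.sum_congr rfl fun i _ => by ring
    simp only [this]
    have hI' : Integrable (fun x => (∑ i, F i (comb p x) * F i (comb p x)) -
        2 * ∑ i, F i (comb p x) * F i (comb q x)) (volume.restrict gaussDomain) :=
      (hIs p p).sub ((hIs p q).const_mul 2)
    rw [integral_add hI' (hIs q q),
      integral_sub (hIs p p) ((hIs p q).const_mul 2), integral_const_mul]
    simp only [corr] at hp hq hpq
    rw [hp, hq, hpq]; ring
  rw [integral_eq_zero_iff_of_nonneg] at h0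
  · filter_upwards [h0] with x hx i
    have := (Finset.sum_eq_zero_iff_of_nonneg fun i _ => sq_nonneg _).1 hx i (Finset.mem_univ i)
    exact sub_eq_zero.1 (pow_eq_zero_iff two_ne_zero |>.1 this)
  · intro x; exact Finset.sum_nonneg fun i _ => sq_nonneg _
  · refine integrable_finsetSum _ fun i _ => ?_
    have := ((hI i p p).sub ((hI i p q).const_mul 2)).add (hI i q q)
    refine this.congr (Eventually.of_forall fun x => ?_)
    simp only [Pi.add_apply, Pi.sub_apply]; ring

lemma tendsto_corr [Fintype ι] {F : ι → Plane → ℝ} (hm : ∀ i, Measurable (F i))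
    (hb : ∀ i v, |F i v| ≤ 1) {a : ℝ} (ha : a ≠ 0) :
    Tendsto (fun b => corr F ![1, 0] ![a, b]) (𝓝 0) (𝓝 (corr F ![1, 0] ![a, 0])) := by
  let S : ℝ → C(Plane × Plane, Plane × Plane) := fun t =>
    ⟨mix 1 (-(t / a)) 0 1, continuous_mix _ _ _ _⟩
  have hS : Continuous S := by
    refine ContinuousMap.continuous_of_continuous_uncurry _ ?_
    change Continuous fun z : ℝ × (Plane × Plane) => mix 1 (-(z.1 / a)) 0 1 z.2
    simp only [mix, comb, Matrix.cons_val_zero, Matrix.cons_val_one]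
    fun_prop
  have hSm : ∀ t, MeasurePreserving (S t) volume volume := fun t => mix_preserving (by ring)
  let k : ι → Plane × Plane → ℝ := fun i =>
    gaussDomain.indicator fun x => F i (comb ![1, 0] x)
  have hk : ∀ i, Integrable (k i) volume := by
    intro i
    refine IntegrableOn.integrable_indicator ?_ isOpen_gaussDomain.measurableSet
    exact Integrable.of_bound (C := 1)
      ((hm i).comp (continuous_comb _).measurable).aestronglyMeasurable
      (Eventually.of_forall fun x => hb _ _)
  have hkS : ∀ i t, Integrable (fun x => k i (S t x)) volume := fun i t =>
    (hSm t).integrable_comp_of_integrable (hk i)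
  have hFm : ∀ i, AEStronglyMeasurable (fun x : Plane × Plane => F i (comb ![a, 0] x)) volume :=
    fun i => ((hm i).comp (continuous_comb _).measurable).aestronglyMeasurable
  have hprod : ∀ i t, Integrable (fun x => k i (S t x) * F i (comb ![a, 0] x)) volume :=
    fun i t => (hkS i t).mul_bdd (hFm i) (Eventually.of_forall fun x => hb _ _)
  have hcorr : ∀ b, corr F ![1, 0] ![a, b] =
      ∑ i, ∫ x, k i (S b x) * F i (comb ![a, 0] x) := by
    intro b
    rw [corr, integral_finsetSum _ fun i _ => integrable_corr hm hb i _ _]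
    refine Finset.sum_congr rfl fun i _ => ?_
    rw [← integral_indicator isOpen_gaussDomain.measurableSet,
      ← (hSm b).integral_comp (mix_measurableEmbedding (by ring))]
    refine integral_congr_ae (Eventually.of_forall fun x => ?_)
    have e : comb ![a, b] (S b x) = comb ![a, 0] x := by
      change comb ![a, b] (mix 1 (-(b / a)) 0 1 x) = _
      rw [comb_mix]
      congr 1
      ext j; fin_cases j
      · simp
      · simp; field_simp; ring
    by_cases hx : S b x ∈ gaussDomain
    · simp only [k, Set.indicator_of_mem hx, e]
    · simp only [k, Set.indicator_of_notMem hx, zero_mul]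
  rw [show corr F ![1, 0] ![a, 0] = _ from hcorr 0]
  simp only [hcorr]
  refine tendsto_finsetSum _ fun i _ => ?_
  rw [tendsto_iff_norm_sub_tendsto_zero]
  refine squeeze_zero (fun t => norm_nonneg _) (fun t => ?_)
    (tendsto_integral_norm_comp_sub (hk i) S hS hSm)
  rw [← integral_sub (hprod i t) (hprod i 0)]
  refine (norm_integral_le_integral_norm _).trans ?_
  refine integral_mono ((hprod i t).sub (hprod i 0)).norm ((hkS i t).sub (hkS i 0)).norm
    fun x => ?_
  simp only [← sub_mul, norm_mul]
  exact mul_le_of_le_one_right (norm_nonneg _) (hb _ _)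

lemma ae_fst_eq_snd [Fintype ι] [MulAction SL2Z ι] {F : ι → Plane → ℝ} (hm : ∀ i, Measurable (F i))
    (hb : ∀ i v, |F i v| ≤ 1) (hF : ∀ (g : SL2Z) i v, F (g • i) (g • v) = F i v) :
    ∀ᵐ x ∂(volume.restrict unitPairs), ∀ i, F i x.1 = F i x.2 := by
  have hshear : ∀ a b : ℝ, b ≠ 0 → corr F ![1, 0] ![a, b] = corr F ![1, 0] ![0, b] := by
    intro a b hb0
    rw [← corr_mix hF (p := 1) (q := 0) (r := a / b) (s := 1) (by ring) ![1, 0] ![0, b]]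
    congr 1 <;> ext j <;> fin_cases j <;> simp
    field_simp
  have hlim : ∀ a : ℝ, a ≠ 0 → Tendsto (fun b => corr F ![1, 0] ![0, b]) (𝓝[≠] 0)
      (𝓝 (corr F ![1, 0] ![a, 0])) := by
    intro a ha
    refine ((tendsto_corr hm hb ha).mono_left nhdsWithin_le_nhds).congr' ?_
    filter_upwards [self_mem_nhdsWithin] with b hb0 using hshear a b hb0
  have hconst : ∀ a : ℝ, a ≠ 0 → corr F ![1, 0] ![a, 0] = corr F ![1, 0] ![1, 0] := fun a ha =>
    tendsto_nhds_unique (hlim a ha) (hlim 1 one_ne_zero)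
  have hscale : ∀ a : ℝ, a ≠ 0 → ∀ᵐ x ∂(volume.restrict gaussDomain), ∀ i,
      F i (comb ![a, 0] x) = F i (comb ![1, 0] x) := by
    intro a ha
    refine ae_eq_of_corr hm hb (L := corr F ![1, 0] ![1, 0]) ?_ rfl ?_
    · rw [← corr_mix hF (p := a) (q := 0) (r := 0) (s := a⁻¹) (by field_simp; ring)
        ![1, 0] ![1, 0]]
      congr 1 <;> ext j <;> fin_cases j <;> simp
    · rw [corr_comm, hconst a ha]
  have hψ : ∀ b : ℝ, b ≠ 0 → corr F ![1, 0] ![0, b] = corr F ![1, 0] ![0, 1] := by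
    intro b hb0
    rw [← corr_mix hF (p := b) (q := 0) (r := 0) (s := b⁻¹) (by field_simp; ring)
        ![1, 0] ![0, b]]
    have e1 : ![(![1, 0] : Plane) 0 * b + (![1, 0] : Plane) 1 * 0,
      (![1, 0] : Plane) 0 * 0 + (![1, 0] : Plane) 1 * b⁻¹] = ![b, 0] := by
        ext j; fin_cases j <;> simp
    have e2 : ![(![0, b] : Plane) 0 * b + (![0, b] : Plane) 1 * 0,
      (![0, b] : Plane) 0 * 0 + (![0, b] : Plane) 1 * b⁻¹] = ![0, 1] := by
        ext j; fin_cases j <;> simp [hb0]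
    rw [e1, e2]
    refine integral_congr_ae ?_
    filter_upwards [hscale b hb0] with x hx
    simp only [hx]
  have hL : corr F ![1, 0] ![0, 1] = corr F ![1, 0] ![1, 0] := by
    refine tendsto_nhds_unique ?_ (hlim 1 one_ne_zero)
    refine tendsto_const_nhds.congr' ?_
    filter_upwards [self_mem_nhdsWithin] with b hb0 using (hψ b hb0).symm
  have hD : ∀ᵐ x ∂(volume.restrict gaussDomain), ∀ i, F i x.1 = F i x.2 := by
    have h := ae_eq_of_corr hm hb (p := ![1, 0]) (q := ![0, 1]) (L := corr F ![1, 0] ![1, 0])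
      rfl ?_ hL
    · simpa [comb] using h
    · rw [← corr_mix hF (p := 0) (q := 1) (r := -1) (s := 0) (by ring) ![1, 0] ![1, 0]]
      congr 1 <;> ext j <;> fin_cases j <;> simp
  rw [← restrict_gaussDomain, ae_iff, Measure.restrict_apply₀'
    gaussDomain_isFundamentalDomain.nullMeasurableSet] at hD
  rw [ae_iff]
  refine gaussDomain_isFundamentalDomain.measure_zero_of_invariant _ (fun g => ?_) hD
  ext x
  rw [Set.mem_smul_set_iff_inv_smul_mem]
  simp only [Set.mem_ofPred_eq, not_iff_not, Prod.smul_fst, Prod.smul_snd]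
  have hF' : ∀ i v, F i (g⁻¹ • v) = F (g • i) v := fun i v => by
    rw [← hF g i (g⁻¹ • v), smul_inv_smul]
  simp only [hF']
  exact (MulAction.toPerm g).forall_congr_right (q := fun i => F i x.1 = F i x.2)

end Correlation

lemma ae_const_of_ae_fst_eq_snd {f : Plane → ℝ}
    (h : ∀ᵐ x ∂(volume.restrict unitPairs), f x.1 = f x.2) :
    ∃ c, ∀ᵐ v, f v = c := by
  rw [ae_restrict_iff' isOpen_unitPairs.measurableSet, Measure.volume_eq_prod] at h
  have h := Measure.ae_ae_of_ae_prod h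
  have hline : ∀ v₀ : Plane, v₀ ≠ 0 → ∀ᵐ v : Plane, pairDet (v₀, v) ≠ 0 := by
    intro v₀ hv₀
    let φ : Plane →ₗ[ℝ] ℝ := v₀ 0 • LinearMap.proj 1 - v₀ 1 • LinearMap.proj 0
    have hφ : ∀ v, φ v = pairDet (v₀, v) := fun v => by simp [φ, pairDet]
    have := Measure.addHaar_submodule (volume : Measure Plane) (LinearMap.ker φ) (by
      intro htop
      apply hv₀
      rw [LinearMap.ker_eq_top] at htop
      have h1 := LinearMap.congr_fun htop ![1, 0]
      have h2 := LinearMap.congr_fun htop ![0, 1]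
      simp [φ] at h1 h2
      ext i; fin_cases i <;> simp [h1, h2])
    rw [ae_iff]
    convert this using 2
    ext v; simp [hφ]
  have hne : ∀ᵐ v : Plane, v ≠ 0 := by simp [ae_iff]
  obtain ⟨v₀, hv₀, hv₀ne⟩ := (h.and hne).exists
  refine ⟨f v₀, ?_⟩
  filter_upwards [h, hline v₀ hv₀ne] with v hv hvd
  have hopen : IsOpen {w : Plane | pairDet (v₀, w) ∈ Set.Ioo 0 1 ∧ pairDet (v, w) ∈ Set.Ioo 0 1} :=
    (isOpen_Ioo.preimage (continuous_pairDet.comp (by fun_prop))).inter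
      (isOpen_Ioo.preimage (continuous_pairDet.comp (by fun_prop)))
  have hnonempty : {w : Plane | pairDet (v₀, w) ∈ Set.Ioo 0 1 ∧
      pairDet (v, w) ∈ Set.Ioo 0 1}.Nonempty := by
    refine ⟨(1 / (2 * pairDet (v₀, v))) • (v - v₀), ?_⟩
    have e1 : pairDet (v₀, (1 / (2 * pairDet (v₀, v))) • (v - v₀)) = 1 / 2 := by
      have : pairDet (v₀, (1 / (2 * pairDet (v₀, v))) • (v - v₀)) =
        (1 / (2 * pairDet (v₀, v))) * pairDet (v₀, v) := by simp [pairDet]; ring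
      rw [this]; field_simp
    have e2 : pairDet (v, (1 / (2 * pairDet (v₀, v))) • (v - v₀)) = 1 / 2 := by
      have : pairDet (v, (1 / (2 * pairDet (v₀, v))) • (v - v₀)) =
        (1 / (2 * pairDet (v₀, v))) * pairDet (v₀, v) := by simp [pairDet]; ring
      rw [this]; field_simp
    simp only [Set.mem_ofPred_eq, e1, e2]
    norm_num
  have hpos := hopen.measure_pos volume hnonempty
  have hfr : ∃ᵐ w : Plane, w ∈ {w : Plane | pairDet (v₀, w) ∈ Set.Ioo 0 1 ∧
      pairDet (v, w) ∈ Set.Ioo 0 1} := by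
    rw [frequently_ae_iff]; exact hpos.ne'
  obtain ⟨w, ⟨hw1, hw2⟩, h1, h2⟩ := (hfr.and_eventually (hv₀.and hv)).exists
  exact (h2 hw2).trans (h1 hw1).symm

/-- Ergodicity of the action of finite-index subgroups of `SL(2,ℤ)` on the plane. -/
theorem ae_const_of_invariant (G : Subgroup SL2Z) (hG : G.index ≠ 0) {f : Plane → ℝ}
    (hm : Measurable f) (hb : ∀ v, |f v| ≤ 1) (hinv : ∀ g ∈ G, ∀ v, f (g • v) = f v) :
    ∃ c, ∀ᵐ v, f v = c := by
  have : G.FiniteIndex := ⟨hG⟩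
  have : Fintype (SL2Z ⧸ G) := Subgroup.fintypeQuotientOfFiniteIndex
  let F : SL2Z ⧸ G → Plane → ℝ := fun i v => f ((Quotient.out i)⁻¹ • v)
  have hFmk : ∀ (h : SL2Z) v, F (h : SL2Z ⧸ G) v = f (h⁻¹ • v) := by
    intro h v
    obtain ⟨g, hg⟩ := QuotientGroup.mk_out_eq_mul G h
    simp only [F]
    rw [hg, mul_inv_rev, mul_smul, hinv _ (inv_mem g.2)]
  have hF : ∀ (g : SL2Z) i v, F (g • i) (g • v) = F i v := by
    intro g i v
    induction i using QuotientGroup.induction_on with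
    | H h =>
      rw [MulAction.Quotient.smul_coe, smul_eq_mul, hFmk, hFmk, mul_inv_rev, mul_smul,
        inv_smul_smul]
  have h := ae_fst_eq_snd (F := F) (fun i => hm.comp (measurable_const_smul _)) (fun i v => hb _) hF
  refine ae_const_of_ae_fst_eq_snd ?_
  filter_upwards [h] with x hx
  have := hx ((1 : SL2Z) : SL2Z ⧸ G)
  simpa [hFmk] using this

/-- A measure dominated by the Lebesgue measure and invariant under a finite-index subgroup of
`SL(2,ℤ)` is a multiple of the Lebesgue measure. -/
theorem eq_smul_volume_of_invariant (G : Subgroup SL2Z) (hG : G.index ≠ 0) (μ : Measure Plane)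
    (hμ : μ ≤ volume) [SigmaFinite μ]
    (hinv : ∀ g ∈ G, μ.map (fun v : Plane => g • v) = μ) :
    ∃ c : ENNReal, c ≠ ⊤ ∧ μ = c • volume := by
  let ρ : Plane → ENNReal := μ.rnDeriv volume
  have hρm : Measurable ρ := Measure.measurable_rnDeriv _ _
  have hρ1 : ρ ≤ᵐ[volume] 1 := Measure.rnDeriv_le_one_of_le hμ
  have hρinv : ∀ g : G, ∀ᵐ v, ρ ((g : SL2Z) • v) = ρ v := by
    intro g
    have h := (measurableEmbedding_const_smul (α := Plane) (g : SL2Z)).rnDeriv_map μ volume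
    rw [hinv g g.2, (measurePreserving_smul (g : SL2Z) (volume : Measure Plane)).map_eq] at h
    exact h
  let f : Plane → ℝ := fun v => (min 1 (⨆ g : G, ρ ((g : SL2Z) • v))).toReal
  have hfm : Measurable f :=
    (measurable_const.min (Measurable.iSup fun g : G =>
      hρm.comp (measurable_const_smul (g : SL2Z)))).ennreal_toReal
  have hf : ∀ g ∈ G, ∀ v, f (g • v) = f v := by
    intro g hg v
    simp only [f]
    congr 2
    rw [← (Equiv.mulRight (⟨g, hg⟩ : G)).iSup_comp (g := fun h : G => ρ ((h : SL2Z) • v))]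
    simp [mul_smul]
  obtain ⟨c, hc⟩ := ae_const_of_invariant G hG hfm (fun v => by
    rw [abs_of_nonneg ENNReal.toReal_nonneg]
    exact ENNReal.toReal_mono ENNReal.one_ne_top (min_le_left _ _)) hf
  refine ⟨ENNReal.ofReal c, ENNReal.ofReal_ne_top, ?_⟩
  have hρc : ρ =ᵐ[volume] fun _ => ENNReal.ofReal c := by
    filter_upwards [hc, hρ1, ae_all_iff.2 hρinv] with v h1 h2 h3
    simp only [f, h3, ciSup_const] at h1
    rw [← h1, min_eq_right (show ρ v ≤ 1 from h2),
      ENNReal.ofReal_toReal (ne_top_of_le_ne_top ENNReal.one_ne_top h2)]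
  rw [← Measure.withDensity_rnDeriv_eq μ volume (Measure.absolutelyContinuous_of_le hμ),
    withDensity_congr_ae hρc, withDensity_const]

/-- The inclusion of the integer lattice in the plane. -/
def latticeEmb (v : Fin 2 → ℤ) : Plane := fun i => (v i : ℝ)

lemma latticeEmb_smul (g : SL2Z) (v : Fin 2 → ℤ) : latticeEmb (g • v) = g • latticeEmb v := by
  ext i; fin_cases i
  · simp [latticeEmb, plane_smul_zero, Matrix.SpecialLinearGroup.smul_def, Matrix.mulVec,
      dotProduct, Fin.sum_univ_two]
  · simp [latticeEmb, plane_smul_one, Matrix.SpecialLinearGroup.smul_def, Matrix.mulVec,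
      dotProduct, Fin.sum_univ_two]

lemma norm_latticeEmb (v : Fin 2 → ℤ) : ‖latticeEmb v‖ = ‖v‖ := by
  simp only [Pi.norm_def, latticeEmb]
  congr 2

lemma latticeEmb_injective : Function.Injective latticeEmb := fun v w h => by
  ext i
  have : (v i : ℝ) = w i := congrFun h i
  exact_mod_cast this

lemma finite_lattice_ball (r : ℝ) : {v : Fin 2 → ℤ | ‖v‖ ≤ r}.Finite := by
  have h := isCompact_iff_finite.1 (isCompact_closedBall (0 : Fin 2 → ℤ) r)
  refine h.subset fun v hv => ?_
  simpa using hv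

/-- The normalised sum of `φ` over the points of `n⁻¹ Q`. -/
noncomputable def latticeAvg (Q : Set (Fin 2 → ℤ)) (φ : Plane → ℝ) (n : ℕ) : ℝ :=
  (∑' v, Q.indicator (fun v => φ ((n : ℝ)⁻¹ • latticeEmb v)) v) / n ^ 2

lemma finite_support_scaled {φ : Plane → ℝ} (hφ : HasCompactSupport φ) {n : ℕ} (hn : n ≠ 0) :
    (Function.support fun v => φ ((n : ℝ)⁻¹ • latticeEmb v)).Finite := by
  obtain ⟨B, hB⟩ := hφ.isCompact.isBounded.exists_norm_le
  refine (finite_lattice_ball (n * B)).subset fun v hv => ?_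
  have hn' : (0 : ℝ) < n := by positivity
  have h := hB _ (subset_tsupport _ hv)
  rw [norm_smul, norm_latticeEmb, norm_inv, RCLike.norm_natCast, inv_mul_le_iff₀ hn'] at h
  exact h

lemma summable_scaled (Q : Set (Fin 2 → ℤ)) {φ : Plane → ℝ} (hφ : HasCompactSupport φ) {n : ℕ}
    (hn : n ≠ 0) : Summable (Q.indicator fun v => φ ((n : ℝ)⁻¹ • latticeEmb v)) :=
  (summable_of_hasFiniteSupport (finite_support_scaled hφ hn)).indicator Q

lemma latticeAvg_zero (Q : Set (Fin 2 → ℤ)) (φ : Plane → ℝ) : latticeAvg Q φ 0 = 0 := by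
  simp [latticeAvg]

lemma latticeAvg_add (Q : Set (Fin 2 → ℤ)) {φ ψ : Plane → ℝ} (hφ : HasCompactSupport φ)
    (hψ : HasCompactSupport ψ) (n : ℕ) :
    latticeAvg Q (φ + ψ) n = latticeAvg Q φ n + latticeAvg Q ψ n := by
  rcases eq_or_ne n 0 with rfl | hn
  · simp [latticeAvg_zero]
  · rw [latticeAvg, latticeAvg, latticeAvg, ← add_div,
      ← (summable_scaled Q hφ hn).tsum_add (summable_scaled Q hψ hn)]
    simp only [Pi.add_apply, ← Set.indicator_add]

lemma latticeAvg_smul (Q : Set (Fin 2 → ℤ)) (c : ℝ) (φ : Plane → ℝ) (n : ℕ) :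
    latticeAvg Q (c • φ) n = c * latticeAvg Q φ n := by
  rw [latticeAvg, latticeAvg, ← mul_div_assoc, ← tsum_mul_left]
  congr 2
  ext v
  by_cases hv : v ∈ Q <;> simp [hv]

lemma latticeAvg_mono {Q Q' : Set (Fin 2 → ℤ)} (hQ : Q ⊆ Q') {φ ψ : Plane → ℝ}
    (hφ : HasCompactSupport φ) (hψ : HasCompactSupport ψ) (h : φ ≤ ψ) (h0 : 0 ≤ ψ) (n : ℕ) :
    latticeAvg Q φ n ≤ latticeAvg Q' ψ n := by
  rcases eq_or_ne n 0 with rfl | hn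
  · simp [latticeAvg_zero]
  · refine div_le_div_of_nonneg_right ?_ (by positivity)
    refine (summable_scaled Q hφ hn).tsum_le_tsum (fun v => ?_) (summable_scaled Q' hψ hn)
    by_cases hv : v ∈ Q
    · simpa [hv, hQ hv] using h _
    · by_cases hv' : v ∈ Q'
      · simpa [hv, hv'] using h0 _
      · simp [hv, hv']

lemma latticeAvg_le {Q : Set (Fin 2 → ℤ)} {φ ψ : Plane → ℝ}
    (hφ : HasCompactSupport φ) (hψ : HasCompactSupport ψ) (h : φ ≤ ψ) (n : ℕ) :
    latticeAvg Q φ n ≤ latticeAvg Q ψ n := by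
  rcases eq_or_ne n 0 with rfl | hn
  · simp [latticeAvg_zero]
  · refine div_le_div_of_nonneg_right ?_ (by positivity)
    refine (summable_scaled Q hφ hn).tsum_le_tsum (fun v => ?_) (summable_scaled Q hψ hn)
    exact Set.indicator_le_indicator (h _)

lemma latticeAvg_compl (Q : Set (Fin 2 → ℤ)) {φ : Plane → ℝ} (hφ : HasCompactSupport φ) (n : ℕ) :
    latticeAvg Q φ n + latticeAvg Qᶜ φ n = latticeAvg Set.univ φ n := by
  rcases eq_or_ne n 0 with rfl | hn
  · simp [latticeAvg_zero]
  · rw [latticeAvg, latticeAvg, latticeAvg, ← add_div,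
      ← (summable_scaled Q hφ hn).tsum_add (summable_scaled Qᶜ hφ hn)]
    simp only [← Pi.add_apply (Set.indicator Q _), Set.indicator_self_add_compl,
      Set.indicator_univ]

lemma latticeAvg_smul_set (g : SL2Z) {Q Q' : Set (Fin 2 → ℤ)}
    (hQ : ∀ v, g • v ∈ Q' ↔ v ∈ Q) (φ : Plane → ℝ) (n : ℕ) :
    latticeAvg Q (fun x => φ (g • x)) n = latticeAvg Q' φ n := by
  rw [latticeAvg, latticeAvg, ← (MulAction.toPerm g).tsum_eq (Q'.indicator _)]
  congr 2
  ext v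
  rw [MulAction.toPerm_apply]
  by_cases hv : v ∈ Q
  · rw [Set.indicator_of_mem hv, Set.indicator_of_mem ((hQ v).2 hv), latticeEmb_smul,
      plane_smul_smul]
  · rw [Set.indicator_of_notMem hv, Set.indicator_of_notMem (mt (hQ v).1 hv)]

open scoped Pointwise in
lemma tendsto_latticeAvg_univ {φ : Plane → ℝ} (hc : Continuous φ) (hφ : HasCompactSupport φ) :
    Tendsto (latticeAvg Set.univ φ) atTop (𝓝 (∫ x, φ x)) := by
  obtain ⟨B, hB⟩ := hφ.isCompact.isBounded.exists_norm_le
  have hsupp : Function.support φ ⊆ Metric.closedBall (0 : Plane) B := fun x hx => by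
    simpa using hB x (subset_tsupport _ hx)
  have h := tendsto_tsum_div_pow_atTop_integral (Metric.closedBall (0 : Plane) B) φ hc
    Metric.isBounded_closedBall Metric.isClosed_closedBall.measurableSet
    ((convex_closedBall _ _).addHaar_frontier _)
  rw [setIntegral_eq_integral_of_forall_compl_eq_zero fun x hx => by
    by_contra h; exact hx (hsupp h)] at h
  refine h.congr' ?_
  filter_upwards [eventually_ne_atTop 0] with n hn
  have hn' : (n : ℝ) ≠ 0 := by exact_mod_cast hn
  rw [latticeAvg, Fintype.card_fin]
  congr 1
  rw [tsum_subtype (f := φ)]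
  have hinj : Function.Injective fun v : Fin 2 → ℤ => (n : ℝ)⁻¹ • latticeEmb v :=
    (smul_right_injective Plane (inv_ne_zero hn')).comp latticeEmb_injective
  have hmem : ∀ v : Fin 2 → ℤ, (n : ℝ)⁻¹ • latticeEmb v ∈
      (n : ℝ)⁻¹ • (Submodule.span ℤ (Set.range (Pi.basisFun ℝ (Fin 2))) : Set Plane) := by
    intro v
    refine Set.smul_mem_smul_set ?_
    rw [SetLike.mem_coe, Module.Basis.mem_span_iff_repr_mem]
    intro i
    exact ⟨v i, by simp [latticeEmb]⟩
  rw [← hinj.tsum_eq]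
  · refine tsum_congr fun v => ?_
    by_cases hv : (n : ℝ)⁻¹ • latticeEmb v ∈ Metric.closedBall (0 : Plane) B
    · rw [Set.indicator_of_mem (Set.mem_inter hv (hmem v)), Set.indicator_of_mem (Set.mem_univ _)]
    · rw [Set.indicator_of_notMem (fun h => hv h.1), Set.indicator_of_mem (Set.mem_univ _)]
      by_contra h; exact hv (hsupp (Ne.symm h))
  · intro x hx
    have hx := Set.mem_of_indicator_ne_zero hx
    obtain ⟨y, hy, rfl⟩ := hx.2
    rw [SetLike.mem_coe, Module.Basis.mem_span_iff_repr_mem] at hy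
    choose v hv using hy
    refine ⟨v, ?_⟩
    simp only
    congr 1
    ext i
    simpa [latticeEmb] using hv i

instance planeAction_continuous : ContinuousConstSMul SL2Z Plane := ⟨plane_continuous_smul⟩

lemma hasCompactSupport_comp_smul {φ : Plane → ℝ} (hφ : HasCompactSupport φ) (g : SL2Z) :
    HasCompactSupport fun x => φ (g • x) :=
  hφ.comp_homeomorph (Homeomorph.smul g)

section Limit

variable (𝒰 : Ultrafilter ℕ)

/-- The limit of the lattice averages along an ultrafilter. -/
noncomputable def latticeLim (Q : Set (Fin 2 → ℤ)) (φ : Plane → ℝ) : ℝ :=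
  limUnder (𝒰 : Filter ℕ) (latticeAvg Q φ)

variable {𝒰}

lemma abs_latticeAvg_le (Q : Set (Fin 2 → ℤ)) {φ : Plane → ℝ}
    (hφ : HasCompactSupport φ) (n : ℕ) :
    |latticeAvg Q φ n| ≤ latticeAvg Set.univ (fun x => |φ x|) n := by
  have habs : HasCompactSupport fun x => |φ x| := hφ.norm
  rw [abs_le]
  constructor
  · have h := latticeAvg_mono (Set.subset_univ Q) (φ := -φ)
      (hφ.comp_left (g := Neg.neg) neg_zero) habs
      (fun x => neg_le_abs (φ x)) (fun x => abs_nonneg _) n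
    rw [← neg_one_smul ℝ φ, latticeAvg_smul] at h
    linarith
  · exact latticeAvg_mono (Set.subset_univ Q) hφ habs (fun x => le_abs_self (φ x))
      (fun x => abs_nonneg _) n

lemma tendsto_latticeLim (h𝒰 : (𝒰 : Filter ℕ) ≤ atTop) (Q : Set (Fin 2 → ℤ)) {φ : Plane → ℝ}
    (hc : Continuous φ) (hφ : HasCompactSupport φ) :
    Tendsto (latticeAvg Q φ) 𝒰 (𝓝 (latticeLim 𝒰 Q φ)) := by
  refine tendsto_nhds_limUnder ?_
  have habs : HasCompactSupport fun x => |φ x| := hφ.norm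
  have h1 : ∀ᶠ n in (𝒰 : Filter ℕ), latticeAvg Q φ n ∈
      Set.Icc (-((∫ x, |φ x|) + 1)) ((∫ x, |φ x|) + 1) := by
    refine h𝒰 ?_
    have h := (tendsto_latticeAvg_univ hc.abs habs).eventually_le_const
      (lt_add_one (∫ x, |φ x|))
    filter_upwards [h] with n hn
    exact abs_le.1 ((abs_latticeAvg_le Q hφ n).trans hn)
  obtain ⟨L, -, hL⟩ := isCompact_Icc.ultrafilter_le_nhds
    (𝒰.map (latticeAvg Q φ)) (le_principal_iff.2 h1)
  exact ⟨L, hL⟩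

open CompactlySupported in
/-- The limit of the lattice averages, as a positive linear functional. -/
noncomputable def latticeFunctional (h𝒰 : (𝒰 : Filter ℕ) ≤ atTop) (Q : Set (Fin 2 → ℤ)) :
    C_c(Plane, ℝ) →ₚ[ℝ] ℝ where
  toFun φ := latticeLim 𝒰 Q φ
  map_add' φ ψ := by
    refine tendsto_nhds_unique (tendsto_latticeLim h𝒰 Q (φ + ψ).continuous
      (φ + ψ).hasCompactSupport) ?_
    refine ((tendsto_latticeLim h𝒰 Q φ.continuous φ.hasCompactSupport).add
      (tendsto_latticeLim h𝒰 Q ψ.continuous ψ.hasCompactSupport)).congr fun n => ?_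
    exact (latticeAvg_add Q φ.hasCompactSupport ψ.hasCompactSupport n).symm
  map_smul' c φ := by
    refine tendsto_nhds_unique (tendsto_latticeLim h𝒰 Q (c • φ).continuous
      (c • φ).hasCompactSupport) ?_
    refine ((tendsto_latticeLim h𝒰 Q φ.continuous φ.hasCompactSupport).const_mul c).congr
      fun n => ?_
    exact (latticeAvg_smul Q c φ n).symm
  monotone' φ ψ h :=
    le_of_tendsto_of_tendsto' (tendsto_latticeLim h𝒰 Q φ.continuous φ.hasCompactSupport)
      (tendsto_latticeLim h𝒰 Q ψ.continuous ψ.hasCompactSupport) fun n =>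
        latticeAvg_le φ.hasCompactSupport ψ.hasCompactSupport h n

lemma integral_latticeFunctional (h𝒰 : (𝒰 : Filter ℕ) ≤ atTop) (Q : Set (Fin 2 → ℤ))
    {φ : Plane → ℝ} (hc : Continuous φ) (hφ : HasCompactSupport φ) :
    ∫ x, φ x ∂(RealRMK.rieszMeasure (latticeFunctional h𝒰 Q)) = latticeLim 𝒰 Q φ :=
  RealRMK.integral_rieszMeasure (latticeFunctional h𝒰 Q) ⟨⟨φ, hc⟩, hφ⟩

/-- The points of a set of lattice vectors that is invariant under a finite-index subgroup have
an asymptotic density along every ultrafilter. -/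
theorem exists_density_of_invariant (h𝒰 : (𝒰 : Filter ℕ) ≤ atTop) (G : Subgroup SL2Z)
    (hG : G.index ≠ 0) {Q : Set (Fin 2 → ℤ)} (hQ : ∀ g ∈ G, ∀ v, g • v ∈ Q ↔ v ∈ Q) :
    ∃ c : ℝ, ∀ φ : Plane → ℝ, Continuous φ → HasCompactSupport φ →
      latticeLim 𝒰 Q φ = c * ∫ x, φ x := by
  let μ := RealRMK.rieszMeasure (latticeFunctional h𝒰 Q)
  let μ' := RealRMK.rieszMeasure (latticeFunctional h𝒰 Qᶜ)
  have hsum : μ + μ' = volume := by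
    have : IsFiniteMeasureOnCompacts (μ + μ') := ⟨fun K hK => by
      rw [Measure.add_apply]
      exact ENNReal.add_lt_top.2 ⟨hK.measure_lt_top, hK.measure_lt_top⟩⟩
    refine Measure.ext_of_integral_eq_on_compactlySupported fun φ => ?_
    have e (ν : Measure Plane) [IsFiniteMeasureOnCompacts ν] : Integrable (fun x => φ x) ν :=
      φ.continuous.integrable_of_hasCompactSupport φ.hasCompactSupport
    have e1 : ∫ x, φ x ∂μ = latticeLim 𝒰 Q φ :=
      integral_latticeFunctional h𝒰 Q φ.continuous φ.hasCompactSupport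
    have e2 : ∫ x, φ x ∂μ' = latticeLim 𝒰 Qᶜ φ :=
      integral_latticeFunctional h𝒰 Qᶜ φ.continuous φ.hasCompactSupport
    rw [integral_add_measure (e μ) (e μ'), e1, e2]
    refine tendsto_nhds_unique ((tendsto_latticeLim h𝒰 Q φ.continuous φ.hasCompactSupport).add
      (tendsto_latticeLim h𝒰 Qᶜ φ.continuous φ.hasCompactSupport)) ?_
    exact ((tendsto_latticeAvg_univ φ.continuous φ.hasCompactSupport).mono_left h𝒰).congr
      fun n => (latticeAvg_compl Q φ.hasCompactSupport n).symm
  have hle : μ ≤ volume := by rw [← hsum]; exact Measure.le_add_right le_rfl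
  have hinv : ∀ g ∈ G, μ.map (fun v : Plane => g • v) = μ := by
    intro g hg
    have : (μ.map (fun v : Plane => g • v)).Regular :=
      Measure.Regular.map (μ := μ) (Homeomorph.smul g)
    refine Measure.ext_of_integral_eq_on_compactlySupported fun φ => ?_
    have e1 : ∫ x, φ x ∂μ = latticeLim 𝒰 Q φ :=
      integral_latticeFunctional h𝒰 Q φ.continuous φ.hasCompactSupport
    have e2 : ∫ x, φ (g • x) ∂μ = latticeLim 𝒰 Q fun x => φ (g • x) :=
      integral_latticeFunctional h𝒰 Q (φ := fun x => φ (g • x))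
        (φ.continuous.comp (continuous_const_smul g))
        (hasCompactSupport_comp_smul φ.hasCompactSupport g)
    rw [integral_map (φ := fun v : Plane => g • v) (f := φ)
      (measurable_const_smul g).aemeasurable φ.continuous.aestronglyMeasurable, e1, e2]
    simp only [latticeLim]
    congr 1
    ext n
    exact latticeAvg_smul_set g (hQ g hg) φ n
  obtain ⟨c, hc, hμ⟩ := eq_smul_volume_of_invariant G hG μ hle hinv
  refine ⟨c.toReal, fun φ h1 h2 => ?_⟩
  rw [← integral_latticeFunctional h𝒰 Q h1 h2]
  change ∫ x, φ x ∂μ = _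
  rw [hμ, integral_smul_measure, smul_eq_mul]

end Limit

/-- The first column of a matrix. -/
def firstCol (g : SL2Z) : Fin 2 → ℤ := fun i => g.1 i 0

lemma firstCol_mul (g h : SL2Z) : firstCol (g * h) = g • firstCol h := by
  ext i
  simp [firstCol, Matrix.SpecialLinearGroup.smul_def, Matrix.mulVec, dotProduct, Matrix.mul_apply]

lemma sl2z_mul_apply (g h : SL2Z) (i j : Fin 2) :
    (g * h).1 i j = g.1 i 0 * h.1 0 j + g.1 i 1 * h.1 1 j := by
  rw [← Fin.sum_univ_two fun m => g.1 i m * h.1 m j, ← Matrix.mul_apply]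
  rfl

lemma transMat_val (k : ℤ) : (transMat k).1 = !![1, k; 0, 1] := rfl

lemma transMat_mul (k l : ℤ) : transMat k * transMat l = transMat (k + l) := by
  ext i j
  fin_cases i <;> fin_cases j <;> simp [sl2z_mul_apply, transMat_val, add_comm]

lemma transMat_zero : transMat 0 = 1 := by
  ext i j
  fin_cases i <;> fin_cases j <;> simp [transMat]

lemma transMat_neg (k : ℤ) : transMat (-k) = (transMat k)⁻¹ :=
  eq_inv_of_mul_eq_one_left (by rw [transMat_mul, neg_add_cancel, transMat_zero])

lemma firstCol_mul_transMat (g : SL2Z) (k : ℤ) : firstCol (g * transMat k) = firstCol g := by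
  ext i
  simp [firstCol, sl2z_mul_apply, transMat_val]

lemma firstCol_eq_iff {g h : SL2Z} : firstCol g = firstCol h ↔ ∃ k, h = g * transMat k := by
  refine ⟨fun he => ?_, ?_⟩
  · have h0 : g.1 0 0 = h.1 0 0 := congrFun he 0
    have h1 : g.1 1 0 = h.1 1 0 := congrFun he 1
    have hg := sl2z_det g
    have hh := sl2z_det h
    rw [← h0, ← h1] at hh
    refine ⟨g.1 1 1 * h.1 0 1 - g.1 0 1 * h.1 1 1, ?_⟩
    ext i j
    fin_cases i <;> fin_cases j <;>
      simp [sl2z_mul_apply, transMat_val, ← h0, ← h1]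
    · linear_combination g.1 0 1 * hh - h.1 0 1 * hg
    · linear_combination g.1 1 1 * hh - h.1 1 1 * hg
  · rintro ⟨k, rfl⟩
    exact (firstCol_mul_transMat g k).symm

lemma transMat_mul_mem {G : Subgroup SL2Z} {q : ℤ} (hqG : transMat q ∈ G) (k : ℤ) :
    transMat (q * k) ∈ G := by
  have h : transMat (q * k) = transMat q ^ k := by
    induction k with
    | zero => simp [transMat_zero]
    | succ k ih => rw [mul_add, mul_one, ← transMat_mul, ih, zpow_add_one]
    | pred k ih => rw [mul_sub, mul_one, sub_eq_add_neg, ← transMat_mul, ih, transMat_neg,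
        zpow_sub_one]
  rw [h]
  exact G.zpow_mem hqG k

lemma transMat_mem_iff {G : Subgroup SL2Z} {q : ℕ} (hq0 : 0 < q) (hqG : transMat (q : ℤ) ∈ G)
    (hqmin : ∀ q' : ℕ, 0 < q' → transMat (q' : ℤ) ∈ G → q ≤ q') (k : ℤ) :
    transMat k ∈ G ↔ (q : ℤ) ∣ k := by
  refine ⟨fun hk => ?_, ?_⟩
  · have hq : (0 : ℤ) < q := by exact_mod_cast hq0
    have hm : transMat (k % q) ∈ G := by
      have h := G.mul_mem hk (transMat_mul_mem hqG (-(k / q)))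
      rwa [transMat_mul, mul_neg, ← sub_eq_add_neg, ← Int.emod_def] at h
    obtain ⟨r, hr⟩ := Int.eq_ofNat_of_zero_le (Int.emod_nonneg k hq.ne')
    have hlt := Int.emod_lt_of_pos k hq
    rw [hr] at hm hlt
    rcases Nat.eq_zero_or_pos r with rfl | hr0
    · exact Int.dvd_of_emod_eq_zero hr
    · have := hqmin r hr0 hm
      omega
  · rintro ⟨m, rfl⟩
    exact transMat_mul_mem hqG m

/-- The first columns of the matrices in a coset. -/
def cosetCols {G : Subgroup SL2Z} (x : SL2Z ⧸ G) : Set (Fin 2 → ℤ) :=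
  {v | ∃ h : SL2Z, (h : SL2Z ⧸ G) = x ∧ firstCol h = v}

lemma smul_mem_cosetCols {G : Subgroup SL2Z} (g : SL2Z) (x : SL2Z ⧸ G) (v : Fin 2 → ℤ) :
    g • v ∈ cosetCols (g • x) ↔ v ∈ cosetCols x := by
  have key : ∀ (g : SL2Z) (x : SL2Z ⧸ G) (v : Fin 2 → ℤ), v ∈ cosetCols x →
      g • v ∈ cosetCols (g • x) := by
    rintro g x v ⟨h, rfl, rfl⟩
    exact ⟨g * h, rfl, firstCol_mul g h⟩
  refine ⟨fun h => ?_, key g x v⟩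
  simpa using key g⁻¹ _ _ h

/-- The primitive lattice vectors. -/
def primVecs : Set (Fin 2 → ℤ) := {v | IsCoprime (v 0) (v 1)}

lemma mem_primVecs_iff {v : Fin 2 → ℤ} : v ∈ primVecs ↔ ∃ h : SL2Z, firstCol h = v := by
  refine ⟨fun hv => ?_, ?_⟩
  · obtain ⟨a, b, h⟩ := hv
    refine ⟨⟨!![v 0, -b; v 1, a], ?_⟩, ?_⟩
    · rw [Matrix.det_fin_two_of]
      linear_combination h
    · ext i
      fin_cases i <;> simp [firstCol]
  · rintro ⟨h, rfl⟩
    exact ⟨h.1 1 1, -h.1 0 1, by simp only [firstCol]; linear_combination sl2z_det h⟩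

open Classical in
lemma card_cosetCols {G : Subgroup SL2Z} [Fintype (SL2Z ⧸ G)] {q : ℕ} (hq0 : 0 < q)
    (hqG : transMat (q : ℤ) ∈ G)
    (hqmin : ∀ q' : ℕ, 0 < q' → transMat (q' : ℤ) ∈ G → q ≤ q') {v : Fin 2 → ℤ}
    (hv : v ∈ primVecs) :
    (Finset.univ.filter fun x : SL2Z ⧸ G => v ∈ cosetCols x).card = q := by
  obtain ⟨h, rfl⟩ := mem_primVecs_iff.1 hv
  have hmem : ∀ k l : ℤ, ((h * transMat k : SL2Z) : SL2Z ⧸ G) = (h * transMat l : SL2Z) ↔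
      (q : ℤ) ∣ l - k := fun k l => by
    rw [QuotientGroup.eq, mul_inv_rev, mul_assoc, inv_mul_cancel_left, ← transMat_neg,
      transMat_mul, transMat_mem_iff hq0 hqG hqmin, neg_add_eq_sub]
  have himg : (Finset.univ.filter fun x : SL2Z ⧸ G => firstCol h ∈ cosetCols x) =
      (Finset.range q).image fun k : ℕ => ((h * transMat k : SL2Z) : SL2Z ⧸ G) := by
    ext x
    simp only [Finset.mem_filter, Finset.mem_univ, true_and, Finset.mem_image, Finset.mem_range]
    constructor
    · rintro ⟨h', rfl, hh⟩
      obtain ⟨k, rfl⟩ := firstCol_eq_iff.1 hh.symm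
      have hq : (0 : ℤ) < q := by exact_mod_cast hq0
      obtain ⟨r, hr⟩ := Int.eq_ofNat_of_zero_le (Int.emod_nonneg k hq.ne')
      have hlt := Int.emod_lt_of_pos k hq
      refine ⟨r, by omega, (hmem _ _).2 ?_⟩
      have := Int.dvd_self_sub_emod (x := k) (m := q)
      simpa [hr] using this
    · rintro ⟨k, -, rfl⟩
      exact ⟨_, rfl, firstCol_mul_transMat h k⟩
  rw [himg, Finset.card_image_of_injOn, Finset.card_range]
  intro k hk l hl hkl
  have hd := (hmem _ _).1 hkl
  simp only [Finset.coe_range, Set.mem_Iio] at hk hl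
  have := Int.eq_zero_of_abs_lt_dvd hd (by rw [abs_lt]; omega)
  omega

lemma sum_latticeAvg_cosetCols {G : Subgroup SL2Z} [Fintype (SL2Z ⧸ G)] {q : ℕ} (hq0 : 0 < q)
    (hqG : transMat (q : ℤ) ∈ G)
    (hqmin : ∀ q' : ℕ, 0 < q' → transMat (q' : ℤ) ∈ G → q ≤ q') {φ : Plane → ℝ}
    (hφ : HasCompactSupport φ) (n : ℕ) :
    ∑ x : SL2Z ⧸ G, latticeAvg (cosetCols x) φ n = q * latticeAvg primVecs φ n := by
  classical
  rcases eq_or_ne n 0 with rfl | hn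
  · simp [latticeAvg_zero]
  simp only [latticeAvg]
  rw [← Finset.sum_div, ← Summable.tsum_finsetSum fun x _ => summable_scaled _ hφ hn,
    ← mul_div_assoc, ← tsum_mul_left]
  congr 2
  ext v
  simp only [Set.indicator_apply]
  rw [← Finset.sum_filter, Finset.sum_const, nsmul_eq_mul]
  by_cases hv : v ∈ primVecs
  · rw [card_cosetCols hq0 hqG hqmin hv, if_pos hv]
  · rw [if_neg hv, Finset.filter_eq_empty_iff.2]
    · simp
    · rintro x - ⟨h, -, hh⟩
      exact hv (mem_primVecs_iff.2 ⟨h, hh⟩)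

variable {𝒰 : Ultrafilter ℕ}

theorem latticeLim_cosetCols (h𝒰 : (𝒰 : Filter ℕ) ≤ atTop) (G : Subgroup SL2Z)
    (hG : G.index ≠ 0) {q : ℕ} (hq0 : 0 < q) (hqG : transMat (q : ℤ) ∈ G)
    (hqmin : ∀ q' : ℕ, 0 < q' → transMat (q' : ℤ) ∈ G → q ≤ q') {φ : Plane → ℝ}
    (hc : Continuous φ) (hφ : HasCompactSupport φ) :
    G.index * latticeLim 𝒰 (cosetCols ((1 : SL2Z) : SL2Z ⧸ G)) φ =
      q * latticeLim 𝒰 primVecs φ := by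
  have : G.FiniteIndex := ⟨hG⟩
  have : Fintype (SL2Z ⧸ G) := Fintype.ofFinite _
  have hQ : ∀ g ∈ G, ∀ v, g • v ∈ cosetCols ((1 : SL2Z) : SL2Z ⧸ G) ↔
      v ∈ cosetCols ((1 : SL2Z) : SL2Z ⧸ G) := fun g hg v => by
    have h : g • ((1 : SL2Z) : SL2Z ⧸ G) = ((1 : SL2Z) : SL2Z ⧸ G) := by
      rw [MulAction.Quotient.smul_coe, QuotientGroup.eq]
      simpa using hg
    have := smul_mem_cosetCols g ((1 : SL2Z) : SL2Z ⧸ G) v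
    rwa [h] at this
  obtain ⟨c, hden⟩ := exists_density_of_invariant h𝒰 G hG hQ
  have hx : ∀ x : SL2Z ⧸ G, latticeLim 𝒰 (cosetCols x) φ =
      latticeLim 𝒰 (cosetCols ((1 : SL2Z) : SL2Z ⧸ G)) φ := by
    intro x
    obtain ⟨g, rfl⟩ := QuotientGroup.mk_surjective x
    have h1 : latticeLim 𝒰 (cosetCols ((1 : SL2Z) : SL2Z ⧸ G)) (fun v => φ (g • v)) =
        latticeLim 𝒰 (cosetCols ((g : SL2Z) : SL2Z ⧸ G)) φ := by
      simp only [latticeLim]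
      congr 1
      ext n
      refine latticeAvg_smul_set g (fun v => ?_) φ n
      have := smul_mem_cosetCols g ((1 : SL2Z) : SL2Z ⧸ G) v
      rwa [MulAction.Quotient.smul_coe, smul_eq_mul, mul_one] at this
    rw [← h1, hden (fun v => φ (g • v)) (hc.comp (continuous_const_smul g))
      (hasCompactSupport_comp_smul hφ g), hden φ hc hφ,
      (measurePreserving_smul g (volume : Measure Plane)).integral_comp
        (Homeomorph.smul g).measurableEmbedding]
  have hsum : ∑ x : SL2Z ⧸ G, latticeLim 𝒰 (cosetCols x) φ = q * latticeLim 𝒰 primVecs φ := by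
    refine tendsto_nhds_unique
      (tendsto_finsetSum _ fun x _ => tendsto_latticeLim h𝒰 (cosetCols x) hc hφ) ?_
    refine ((tendsto_latticeLim h𝒰 primVecs hc hφ).const_mul (q : ℝ)).congr fun n => ?_
    exact (sum_latticeAvg_cosetCols hq0 hqG hqmin hφ n).symm
  rw [← hsum, Finset.sum_congr rfl fun x _ => hx x, Finset.sum_const, nsmul_eq_mul,
    Finset.card_univ, ← Nat.card_eq_fintype_card, Subgroup.index]

/-- Every nonzero lattice vector is uniquely a positive multiple of a primitive one. -/
noncomputable def primEquiv : ℕ × primVecs ≃ ({0}ᶜ : Set (Fin 2 → ℤ)) :=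
  Equiv.ofBijective
    (fun p => ⟨((p.1 + 1 : ℕ) : ℤ) • p.2.1, fun h => by
      have hp : IsCoprime (p.2.1 0) (p.2.1 1) := p.2.2
      have h0 : p.2.1 = 0 :=
        (smul_eq_zero.1 (Set.mem_singleton_iff.1 h)).resolve_left (by positivity)
      rw [h0] at hp
      simp [isCoprime_zero_left] at hp⟩) <| by
    have hgcd : ∀ (d : ℕ) (v : Fin 2 → ℤ), v ∈ primVecs →
        Int.gcd (((d : ℤ) • v) 0) (((d : ℤ) • v) 1) = d := fun d v hv => by
      have hv' : Int.gcd (v 0) (v 1) = 1 := Int.isCoprime_iff_gcd_eq_one.1 hv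
      simp [Int.gcd_mul_left, hv']
    refine ⟨?_, ?_⟩
    · rintro ⟨d, v, hv⟩ ⟨e, w, hw⟩ h
      have h : ((d + 1 : ℕ) : ℤ) • v = ((e + 1 : ℕ) : ℤ) • w := congrArg Subtype.val h
      have hde : d + 1 = e + 1 := by rw [← hgcd (d + 1) v hv, ← hgcd (e + 1) w hw, h]
      rw [← hde] at h
      obtain rfl : v = w := smul_right_injective _ (by positivity) h
      obtain rfl : d = e := by omega
      rfl
    · rintro ⟨v, hv⟩
      have hne : v 0 ≠ 0 ∨ v 1 ≠ 0 := by
        by_contra! hcon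
        refine hv (Set.mem_singleton_iff.2 ?_)
        ext i
        fin_cases i
        · exact hcon.1
        · exact hcon.2
      have hg : 0 < Int.gcd (v 0) (v 1) := Int.gcd_pos_iff.2 hne
      refine ⟨⟨Int.gcd (v 0) (v 1) - 1, fun i => v i / Int.gcd (v 0) (v 1), ?_⟩, ?_⟩
      · exact Int.isCoprime_iff_gcd_eq_one.2 (Int.gcd_div_gcd_div_gcd hg)
      · refine Subtype.ext ?_
        ext i
        simp only [Nat.sub_add_cancel hg, Pi.smul_apply, smul_eq_mul]
        refine Int.mul_ediv_cancel' ?_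
        fin_cases i
        · exact Int.gcd_dvd_left _ _
        · exact Int.gcd_dvd_right _ _

lemma primEquiv_apply (p : ℕ × primVecs) :
    (primEquiv p : Fin 2 → ℤ) = ((p.1 + 1 : ℕ) : ℤ) • p.2.1 := rfl

lemma hasCompactSupport_comp_scale {φ : Plane → ℝ} (hφ : HasCompactSupport φ) {d : ℝ}
    (hd : d ≠ 0) : HasCompactSupport fun x => φ (d • x) :=
  hφ.comp_homeomorph (Homeomorph.smulOfNeZero d hd)

lemma latticeEmb_smul_int (d : ℤ) (v : Fin 2 → ℤ) :
    latticeEmb (d • v) = (d : ℝ) • latticeEmb v := by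
  ext i
  simp [latticeEmb]

lemma latticeAvg_ne_zero_eq {φ : Plane → ℝ} (hφ : HasCompactSupport φ) (n : ℕ) :
    latticeAvg {0}ᶜ φ n =
      ∑' d : ℕ, latticeAvg primVecs (fun x => φ (((d + 1 : ℕ) : ℝ) • x)) n := by
  rcases eq_or_ne n 0 with rfl | hn
  · simp [latticeAvg_zero]
  simp only [latticeAvg]
  rw [tsum_div_const]
  congr 1
  rw [← tsum_subtype, ← primEquiv.tsum_eq]
  have hs : Summable fun p => φ ((n : ℝ)⁻¹ • latticeEmb (primEquiv p)) := by
    have h := summable_subtype_iff_indicator.2 (summable_scaled {0}ᶜ hφ hn)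
    exact primEquiv.summable_iff.2 h
  rw [hs.tsum_prod]
  congr 1
  ext d
  rw [← tsum_subtype]
  congr 1
  ext v
  simp only [primEquiv_apply, latticeEmb_smul_int]
  congr 1
  rw [smul_comm]
  simp

lemma tendsto_latticeAvg_singleton (φ : Plane → ℝ) :
    Tendsto (latticeAvg {0} φ) atTop (𝓝 0) := by
  have h : latticeAvg {0} φ = fun n : ℕ => φ 0 / (n : ℝ) ^ 2 := by
    ext n
    rw [latticeAvg, tsum_eq_single 0 fun v hv => by simp [hv]]
    have : latticeEmb 0 = 0 := by ext; simp [latticeEmb]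
    simp [this]
  rw [h]
  exact Tendsto.const_div_atTop
    ((tendsto_pow_atTop two_ne_zero).comp tendsto_natCast_atTop_atTop) _

lemma ncard_ball_le {r : ℝ} (hr : 0 ≤ r) :
    (({v : Fin 2 → ℤ | v ≠ 0 ∧ ‖v‖ ≤ r}.ncard : ℕ) : ℝ) ≤ 9 * r ^ 2 := by
  rcases lt_or_ge r 1 with h1 | h1
  · have : {v : Fin 2 → ℤ | v ≠ 0 ∧ ‖v‖ ≤ r} = ∅ := by
      refine Set.eq_empty_of_forall_notMem ?_
      rintro v ⟨hv, hvr⟩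
      refine hv ?_
      ext i
      have h := (norm_le_pi_norm v i).trans_lt (hvr.trans_lt h1)
      rw [Int.norm_eq_abs] at h
      exact Int.abs_lt_one_iff.1 (by exact_mod_cast h)
    rw [this]
    simp
    positivity
  · have hsub : {v : Fin 2 → ℤ | v ≠ 0 ∧ ‖v‖ ≤ r} ⊆
        (Fintype.piFinset fun _ : Fin 2 => Finset.Icc (-⌊r⌋) ⌊r⌋ : Finset (Fin 2 → ℤ)) := by
      rintro v ⟨-, hv⟩
      simp only [Finset.mem_coe, Fintype.mem_piFinset, Finset.mem_Icc]
      intro i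
      have h := (norm_le_pi_norm v i).trans hv
      rw [Int.norm_eq_abs, ← Int.cast_abs, ← Int.le_floor, abs_le] at h
      exact h
    have hle := Set.ncard_le_ncard hsub (Finset.finite_toSet _)
    rw [Set.ncard_coe_finset, Fintype.card_piFinset] at hle
    simp only [Int.card_Icc, Finset.prod_const, Finset.card_univ, Fintype.card_fin] at hle
    have hf : (0 : ℤ) ≤ ⌊r⌋ := Int.floor_nonneg.2 hr
    have hcast : (((⌊r⌋ + 1 - -⌊r⌋).toNat : ℕ) : ℝ) = 2 * (⌊r⌋ : ℝ) + 1 := by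
      have : (((⌊r⌋ + 1 - -⌊r⌋).toNat : ℕ) : ℤ) = 2 * ⌊r⌋ + 1 := by omega
      exact_mod_cast this
    have hle' : (({v : Fin 2 → ℤ | v ≠ 0 ∧ ‖v‖ ≤ r}.ncard : ℕ) : ℝ) ≤
        (2 * (⌊r⌋ : ℝ) + 1) ^ 2 := by
      rw [← hcast]
      exact_mod_cast hle
    have hfl := Int.floor_le r
    have hf' : (0 : ℝ) ≤ ⌊r⌋ := by exact_mod_cast hf
    nlinarith

lemma abs_latticeAvg_scale_le {φ : Plane → ℝ} {B M : ℝ} (hB0 : 0 ≤ B)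
    (hB : ∀ x, φ x ≠ 0 → ‖x‖ ≤ B) (hM : ∀ x, |φ x| ≤ M) {Q : Set (Fin 2 → ℤ)} (hQ : 0 ∉ Q)
    {d : ℝ} (hd : 0 < d) (n : ℕ) :
    |latticeAvg Q (fun x => φ (d • x)) n| ≤ 9 * M * B ^ 2 * (1 / d ^ 2) := by
  have hM0 : 0 ≤ M := (abs_nonneg _).trans (hM 0)
  rcases eq_or_ne n 0 with rfl | hn
  · rw [latticeAvg_zero, abs_zero]
    positivity
  have hn' : (0 : ℝ) < n := by positivity
  have hfin : {v : Fin 2 → ℤ | v ≠ 0 ∧ ‖v‖ ≤ n * B / d}.Finite :=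
    (finite_lattice_ball _).subset fun v hv => hv.2
  rw [latticeAvg, tsum_eq_sum (s := hfin.toFinset), abs_div, abs_of_pos (by positivity :
    (0 : ℝ) < (n : ℝ) ^ 2), div_le_iff₀ (by positivity)]
  · refine (Finset.abs_sum_le_sum_abs _ _).trans ?_
    refine (Finset.sum_le_card_nsmul _ _ M fun v _ => ?_).trans ?_
    · by_cases hv : v ∈ Q
      · rw [Set.indicator_of_mem hv]
        exact hM _
      · rw [Set.indicator_of_notMem hv, abs_zero]
        exact hM0
    · rw [nsmul_eq_mul, ← Set.ncard_eq_toFinset_card _ hfin]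
      refine (mul_le_mul_of_nonneg_right (ncard_ball_le (by positivity)) hM0).trans (le_of_eq ?_)
      field_simp
  · intro v hv
    by_contra hne
    refine hv (hfin.mem_toFinset.2 ?_)
    have hvQ : v ∈ Q := Set.mem_of_indicator_ne_zero hne
    rw [Set.indicator_of_mem hvQ] at hne
    refine ⟨fun h => hQ (h ▸ hvQ), ?_⟩
    have h := hB _ hne
    rw [norm_smul, norm_smul, norm_latticeEmb, norm_inv, RCLike.norm_natCast, Real.norm_eq_abs,
      abs_of_pos hd, mul_left_comm, inv_mul_le_iff₀ hn'] at h
    rw [le_div_iff₀ hd]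
    linarith

variable {𝒰 : Ultrafilter ℕ}

lemma hasSum_inv_sq_succ : HasSum (fun d : ℕ => 1 / ((d + 1 : ℕ) : ℝ) ^ 2) (Real.pi ^ 2 / 6) := by
  have h := (hasSum_nat_add_iff' 1).2 hasSum_zeta_two
  simpa using h

theorem latticeLim_primVecs (h𝒰 : (𝒰 : Filter ℕ) ≤ atTop) {φ : Plane → ℝ}
    (hc : Continuous φ) (hφ : HasCompactSupport φ) :
    latticeLim 𝒰 primVecs φ = 6 / Real.pi ^ 2 * ∫ x, φ x := by
  have hQ : ∀ g ∈ (⊤ : Subgroup SL2Z), ∀ v, g • v ∈ primVecs ↔ v ∈ primVecs := fun g _ v => by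
    have key : ∀ (g : SL2Z) (v : Fin 2 → ℤ), v ∈ primVecs → g • v ∈ primVecs := by
      intro g v hv
      obtain ⟨h, rfl⟩ := mem_primVecs_iff.1 hv
      exact mem_primVecs_iff.2 ⟨g * h, firstCol_mul g h⟩
    refine ⟨fun h => ?_, key g v⟩
    simpa using key g⁻¹ _ h
  obtain ⟨c, hden⟩ := exists_density_of_invariant h𝒰 ⊤ (by simp) hQ
  have key : ∀ φ : Plane → ℝ, Continuous φ → HasCompactSupport φ →
      ∫ x, φ x = c * (Real.pi ^ 2 / 6) * ∫ x, φ x := by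
    intro φ hc hφ
    obtain ⟨B, hB⟩ := hφ.isCompact.isBounded.exists_norm_le
    obtain ⟨M, hM⟩ := hφ.exists_bound_of_continuous hc
    have hB' : ∀ x, φ x ≠ 0 → ‖x‖ ≤ max B 0 := fun x hx =>
      (hB x (subset_tsupport _ hx)).trans (le_max_left _ _)
    have h0 : (0 : Fin 2 → ℤ) ∉ primVecs := fun h => by
      have h : IsCoprime (0 : ℤ) 0 := h
      simp [isCoprime_zero_left] at h
    have hterm : ∀ d : ℕ, Tendsto (latticeAvg primVecs fun x => φ (((d + 1 : ℕ) : ℝ) • x)) 𝒰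
        (𝓝 (c * (∫ x, φ x) * (1 / ((d + 1 : ℕ) : ℝ) ^ 2))) := fun d => by
      have h1 : Continuous fun x : Plane => φ (((d + 1 : ℕ) : ℝ) • x) :=
        hc.comp (continuous_const_smul _)
      have h2 := hasCompactSupport_comp_scale hφ (d := ((d + 1 : ℕ) : ℝ)) (by positivity)
      have h := tendsto_latticeLim h𝒰 primVecs h1 h2
      rw [hden _ h1 h2, Measure.integral_comp_smul] at h
      convert h using 2
      simp
      ring
    have hlim := tendsto_tsum_of_dominated_convergence
      (hasSum_inv_sq_succ.summable.mul_left (9 * M * (max B 0) ^ 2)) hterm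
      (Eventually.of_forall fun n d => abs_latticeAvg_scale_le (le_max_right _ _) hB' hM h0
        (by positivity) n)
    rw [tsum_mul_left, hasSum_inv_sq_succ.tsum_eq] at hlim
    have hlim2 : Tendsto (latticeAvg {0}ᶜ φ) 𝒰 (𝓝 (∫ x, φ x)) := by
      have h := ((tendsto_latticeAvg_univ hc hφ).sub (tendsto_latticeAvg_singleton φ)).mono_left h𝒰
      rw [sub_zero] at h
      refine h.congr fun n => ?_
      rw [← latticeAvg_compl {0} hφ]
      ring
    have := tendsto_nhds_unique hlim2 (hlim.congr fun n => (latticeAvg_ne_zero_eq hφ n).symm)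
    linarith
  let ψ : Plane → ℝ := fun x => max 0 (1 - ‖x‖)
  have hψc : Continuous ψ := by fun_prop
  have hψs : HasCompactSupport ψ := by
    refine HasCompactSupport.intro (isCompact_closedBall (0 : Plane) 1) fun x hx => ?_
    simp only [Metric.mem_closedBall, dist_zero_right, not_le] at hx
    exact max_eq_left (by linarith)
  have hψp : 0 < ∫ x, ψ x := by
    refine hψc.integral_pos_of_hasCompactSupport_nonneg_nonzero hψs
      (fun x => le_max_left _ _) (x := 0) ?_
    simp [ψ]
  have hcval : c = 6 / Real.pi ^ 2 := by
    have h := key ψ hψc hψs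
    have h1 : c * (Real.pi ^ 2 / 6) = 1 := by
      field_simp at h ⊢
      linarith
    have := Real.pi_ne_zero
    field_simp at h1 ⊢
    linarith
  rw [hden φ hc hφ, hcval]

/-- The asymptotic density of the first columns of the elements of a finite-index subgroup. -/
theorem tendsto_latticeAvg_cosetCols (G : Subgroup SL2Z)
    (hG : G.index ≠ 0) {q : ℕ} (hq0 : 0 < q) (hqG : transMat (q : ℤ) ∈ G)
    (hqmin : ∀ q' : ℕ, 0 < q' → transMat (q' : ℤ) ∈ G → q ≤ q') {φ : Plane → ℝ}
    (hc : Continuous φ) (hφ : HasCompactSupport φ) :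
    Tendsto (latticeAvg (cosetCols ((1 : SL2Z) : SL2Z ⧸ G)) φ) atTop
      (𝓝 (6 * q / (Real.pi ^ 2 * G.index) * ∫ x, φ x)) := by
  rw [tendsto_iff_ultrafilter]
  intro 𝒰 h𝒰
  have h1 := latticeLim_cosetCols h𝒰 G hG hq0 hqG hqmin hc hφ
  rw [latticeLim_primVecs h𝒰 hc hφ] at h1
  have h2 := tendsto_latticeLim h𝒰 (cosetCols ((1 : SL2Z) : SL2Z ⧸ G)) hc hφ
  convert h2 using 2
  have hG' : (G.index : ℝ) ≠ 0 := by exact_mod_cast hG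
  have := Real.pi_ne_zero
  field_simp at h1 ⊢
  linarith

lemma exists_compactSupport_ge {F : Set Plane} (hF : Bornology.IsBounded F)
    (hfr : volume (frontier F) = 0) {δ : ℝ} (hδ : 0 < δ) :
    ∃ φ : Plane → ℝ, Continuous φ ∧ HasCompactSupport φ ∧ F.indicator 1 ≤ φ ∧
      ∫ x, φ x ≤ volume.real F + δ := by
  have hK : IsCompact (closure F) := hF.isCompact_closure
  have hvol : volume (closure F) = volume F :=
    measure_congr (closure_ae_eq_of_null_frontier hfr)
  have hne : volume (closure F) ≠ ⊤ := hK.measure_lt_top.ne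
  obtain ⟨U, hU, hUo, hlt⟩ := (closure F).exists_isOpen_lt_add (μ := volume) hne
    (ENNReal.ofReal_pos.2 hδ).ne'
  have hUt : volume U ≠ ⊤ := ne_top_of_lt hlt
  obtain ⟨f, h1, h0, hs, hI⟩ := exists_continuous_one_zero_of_isCompact hK hUo.isClosed_compl
    (Set.disjoint_compl_right_iff_subset.2 hU)
  refine ⟨f, f.continuous, hs, fun x => ?_, ?_⟩
  · refine Set.indicator_apply_le' (fun hx => ?_) fun _ => (hI x).1
    rw [h1 (subset_closure hx)]
  · have h : ∫ x, f x ≤ ∫ x, U.indicator 1 x := by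
      refine integral_mono (f.continuous.integrable_of_hasCompactSupport hs)
        ((integrable_indicator_iff hUo.measurableSet).2 (integrableOn_const hUt)) fun x => ?_
      by_cases hx : x ∈ U
      · rw [Set.indicator_of_mem hx]
        exact (hI x).2
      · rw [Set.indicator_of_notMem hx, h0 hx]
        rfl
    rw [integral_indicator_one hUo.measurableSet] at h
    refine h.trans ?_
    rw [measureReal_def, measureReal_def, ← hvol, ← ENNReal.toReal_ofReal hδ.le,
      ← ENNReal.toReal_add hne ENNReal.ofReal_ne_top]
    exact ENNReal.toReal_mono (by finiteness) hlt.le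

lemma exists_compactSupport_le {F : Set Plane} (hF : Bornology.IsBounded F)
    (hfr : volume (frontier F) = 0) {δ : ℝ} (hδ : 0 < δ) :
    ∃ φ : Plane → ℝ, Continuous φ ∧ HasCompactSupport φ ∧ φ ≤ F.indicator 1 ∧
      volume.real F - δ ≤ ∫ x, φ x := by
  have hvol : volume (interior F) = volume F :=
    measure_congr (interior_ae_eq_of_null_frontier hfr)
  have hne : volume (interior F) ≠ ⊤ := (hF.subset interior_subset).measure_lt_top.ne
  obtain ⟨K, hKU, hK, hlt⟩ := isOpen_interior.measurableSet.exists_isCompact_lt_add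
    (μ := volume) hne (ENNReal.ofReal_pos.2 hδ).ne'
  obtain ⟨f, h1, h0, hs, hI⟩ := exists_continuous_one_zero_of_isCompact hK
    isOpen_interior.isClosed_compl (Set.disjoint_compl_right_iff_subset.2 hKU)
  refine ⟨f, f.continuous, hs, fun x => ?_, ?_⟩
  · by_cases hx : x ∈ interior F
    · rw [Set.indicator_of_mem (interior_subset hx)]
      exact (hI x).2
    · rw [h0 hx]
      exact Set.indicator_nonneg (fun _ _ => zero_le_one) x
  · have h : ∫ x, K.indicator 1 x ≤ ∫ x, f x := by
      refine integral_mono ((integrable_indicator_iff hK.measurableSet).2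
        (integrableOn_const hK.measure_lt_top.ne))
        (f.continuous.integrable_of_hasCompactSupport hs) fun x => ?_
      refine Set.indicator_apply_le' (fun hx => ?_) fun _ => (hI x).1
      rw [h1 hx]
    rw [integral_indicator_one hK.measurableSet] at h
    refine le_trans ?_ h
    rw [sub_le_iff_le_add, measureReal_def, measureReal_def, ← hvol,
      ← ENNReal.toReal_ofReal hδ.le,
      ← ENNReal.toReal_add hK.measure_lt_top.ne ENNReal.ofReal_ne_top]
    exact ENNReal.toReal_mono (ENNReal.add_ne_top.2 ⟨hK.measure_lt_top.ne, by simp⟩) hlt.le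

lemma tendsto_latticeAvg_indicator {Q : Set (Fin 2 → ℤ)} {c : ℝ} (hc0 : 0 ≤ c)
    (h : ∀ φ : Plane → ℝ, Continuous φ → HasCompactSupport φ →
      Tendsto (latticeAvg Q φ) atTop (𝓝 (c * ∫ x, φ x)))
    {F : Set Plane} (hF : Bornology.IsBounded F) (hfr : volume (frontier F) = 0) :
    Tendsto (latticeAvg Q (F.indicator 1)) atTop (𝓝 (c * volume.real F)) := by
  have hs : HasCompactSupport (F.indicator (1 : Plane → ℝ)) :=
    HasCompactSupport.intro hF.isCompact_closure fun x hx =>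
      Set.indicator_of_notMem (fun h => hx (subset_closure h)) _
  refine tendsto_order.2 ⟨fun a ha => ?_, fun a ha => ?_⟩
  · have hδ : 0 < (c * volume.real F - a) / (c + 1) := div_pos (by linarith) (by linarith)
    obtain ⟨φ, h1, h2, h3, h4⟩ := exists_compactSupport_le hF hfr hδ
    have hlt : a < c * ∫ x, φ x := by
      refine lt_of_lt_of_le ?_ (mul_le_mul_of_nonneg_left h4 hc0)
      have : c * ((c * volume.real F - a) / (c + 1)) < c * volume.real F - a := by
        rw [← mul_div_assoc, div_lt_iff₀ (by linarith)]
        nlinarith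
      rw [mul_sub]
      linarith
    filter_upwards [(h φ h1 h2).eventually_const_lt hlt] with n hn
    exact hn.trans_le (latticeAvg_le h2 hs h3 n)
  · have hδ : 0 < (a - c * volume.real F) / (c + 1) := div_pos (by linarith) (by linarith)
    obtain ⟨φ, h1, h2, h3, h4⟩ := exists_compactSupport_ge hF hfr hδ
    have hlt : c * ∫ x, φ x < a := by
      refine lt_of_le_of_lt (mul_le_mul_of_nonneg_left h4 hc0) ?_
      have : c * ((a - c * volume.real F) / (c + 1)) < a - c * volume.real F := by
        rw [← mul_div_assoc, div_lt_iff₀ (by linarith)]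
        nlinarith
      rw [mul_add]
      linarith
    filter_upwards [(h φ h1 h2).eventually_lt_const hlt] with n hn
    exact (latticeAvg_le hs h2 h3 n).trans_lt hn

/-- The part of a hyperbolic sector between two lines and a hyperbola (in both quadrants). -/
def hypSector (l : ℝ) : Set Plane :=
  {p | 0 < p 0 ∧ |p 1| ≤ p 0 ∧ p 0 < l ^ 2 * |p 1| ∧ p 0 * |p 1| ≤ 1}

lemma isBounded_hypSector (l : ℝ) : Bornology.IsBounded (hypSector l) := by
  refine (Metric.isBounded_closedBall (x := (0 : Plane)) (r := l ^ 2 + 1)).subset ?_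
  rintro p ⟨h0, h1, h2, h3⟩
  have hy : |p 1| ≤ 1 := by nlinarith [abs_nonneg (p 1)]
  rw [mem_closedBall_zero_iff, pi_norm_le_iff_of_nonneg (by positivity), Fin.forall_fin_two]
  simp only [Real.norm_eq_abs, abs_of_pos h0]
  constructor <;> nlinarith [abs_nonneg (p 1), sq_nonneg l]

lemma frontier_hypSector_subset (l : ℝ) : frontier (hypSector l) ⊆
    {p | p 0 = 0 ∨ |p 1| = p 0 ∨ p 0 = l ^ 2 * |p 1| ∨ p 0 * |p 1| = 1} := by
  intro p hp
  have hcl : p ∈ {p : Plane | 0 ≤ p 0 ∧ |p 1| ≤ p 0 ∧ p 0 ≤ l ^ 2 * |p 1| ∧ p 0 * |p 1| ≤ 1} := by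
    refine closure_minimal (s := hypSector l)
      (t := {p : Plane | 0 ≤ p 0 ∧ |p 1| ≤ p 0 ∧ p 0 ≤ l ^ 2 * |p 1| ∧ p 0 * |p 1| ≤ 1})
      (fun x hx => ⟨hx.1.le, hx.2.1, hx.2.2.1.le, hx.2.2.2⟩) ?_ hp.1
    refine IsClosed.and ?_ (IsClosed.and ?_ (IsClosed.and ?_ ?_)) <;>
      exact isClosed_le (by fun_prop) (by fun_prop)
  by_contra hcon
  simp only [Set.mem_ofPred_eq, not_or] at hcon
  obtain ⟨c0, c1, c2, c3⟩ := hcon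
  refine hp.2 (mem_interior.2 ⟨{p : Plane | 0 < p 0 ∧ |p 1| < p 0 ∧ p 0 < l ^ 2 * |p 1| ∧
    p 0 * |p 1| < 1}, fun x hx => ⟨hx.1, hx.2.1.le, hx.2.2.1, hx.2.2.2.le⟩, ?_,
    hcl.1.lt_of_ne' c0, hcl.2.1.lt_of_ne c1, hcl.2.2.1.lt_of_ne c2, hcl.2.2.2.lt_of_ne c3⟩)
  refine IsOpen.and ?_ (IsOpen.and ?_ (IsOpen.and ?_ ?_)) <;>
    exact isOpen_lt (by fun_prop) (by fun_prop)

lemma volume_frontier_hypSector {l : ℝ} (hl : 1 < l) : volume (frontier (hypSector l)) = 0 := by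
  refine measure_mono_null (frontier_hypSector_subset l) (plane_null ?_ ?_)
  · refine MeasurableSet.union ?_ (MeasurableSet.union ?_ (MeasurableSet.union ?_ ?_)) <;>
      exact (isClosed_eq (by fun_prop) (by fun_prop)).measurableSet
  · filter_upwards [Measure.ae_ne volume (0 : ℝ)] with x hx
    refine Set.Countable.mono (s₂ := {x, -x, x / l ^ 2, -(x / l ^ 2), 1 / x, -(1 / x)}) ?_
      (Set.toFinite _).countable
    intro t ht
    have hl2 : l ^ 2 ≠ 0 := by positivity
    have ht : x = 0 ∨ |t| = x ∨ x = l ^ 2 * |t| ∨ x * |t| = 1 := by simpa using ht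
    rcases ht with h | h | h | h
    · exact absurd h hx
    · rcases abs_choice t with ha | ha <;> rw [ha] at h <;> simp [← h]
    · have h : |t| = x / l ^ 2 := by field_simp; linarith
      rcases abs_choice t with ha | ha <;> rw [ha] at h <;> simp [← h]
    · have h : |t| = 1 / x := by field_simp; linarith
      rcases abs_choice t with ha | ha <;> rw [ha] at h <;> simp [← h]

lemma volume_abs_mem_Ioc {a b : ℝ} (ha : 0 < a) :
    volume {y : ℝ | a < |y| ∧ |y| ≤ b} = 2 * ENNReal.ofReal (b - a) := by
  have h : {y : ℝ | a < |y| ∧ |y| ≤ b} = Set.Ioc a b ∪ Set.Ico (-b) (-a) := by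
    ext y
    simp only [Set.mem_ofPred_eq, Set.mem_union, Set.mem_Ioc, Set.mem_Ico]
    rcases abs_cases y with ⟨h1, h2⟩ | ⟨h1, h2⟩ <;> rw [h1] <;> constructor
    · exact fun h => Or.inl h
    · rintro (h | h)
      · exact h
      · linarith [h.2]
    · exact fun h => Or.inr ⟨by linarith [h.2], by linarith [h.1]⟩
    · rintro (h | h)
      · linarith [h.1]
      · exact ⟨by linarith [h.2], by linarith [h.1]⟩
  rw [h, measure_union _ measurableSet_Ico, Real.volume_Ioc, Real.volume_Ico, two_mul]
  · congr 2
    ring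
  · rw [Set.disjoint_left]
    intro y hy hy'
    linarith [hy.1, hy'.2]

lemma lintegral_sector {l : ℝ} (hl : 1 < l) :
    ∫⁻ x in Set.Ioi (0 : ℝ), ENNReal.ofReal (min x (1 / x) - x / l ^ 2) =
      ENNReal.ofReal (Real.log l) := by
  have hl0 : 0 < l := by linarith
  have hsplit : Set.Ioi (0 : ℝ) = Set.Ioc 0 1 ∪ (Set.Ioc 1 l ∪ Set.Ioi l) := by
    rw [Set.Ioc_union_Ioi_eq_Ioi hl.le, Set.Ioc_union_Ioi_eq_Ioi zero_le_one]
  rw [hsplit, lintegral_union (measurableSet_Ioc.union measurableSet_Ioi),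
    lintegral_union measurableSet_Ioi]
  rotate_left
  · rw [Set.disjoint_left]; intro x hx hx'; exact absurd hx.2 (not_le.2 hx')
  · rw [Set.Ioc_union_Ioi_eq_Ioi hl.le, Set.disjoint_left]
    intro x hx hx'; exact absurd hx.2 (not_le.2 hx')
  have e3 : ∫⁻ x in Set.Ioi l, ENNReal.ofReal (min x (1 / x) - x / l ^ 2) = 0 := by
    rw [setLIntegral_congr_fun (g := fun _ => 0) measurableSet_Ioi, lintegral_zero]
    intro x hx
    have hx : l < x := hx
    have hx0 : 0 < x := hl0.trans hx
    refine ENNReal.ofReal_of_nonpos ?_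
    have : 1 / x ≤ x / l ^ 2 := by
      rw [div_le_div_iff₀ hx0 (by positivity)]
      nlinarith
    linarith [min_le_right x (1 / x)]
  have e1 : ∫⁻ x in Set.Ioc (0 : ℝ) 1, ENNReal.ofReal (min x (1 / x) - x / l ^ 2) =
      ENNReal.ofReal ((1 - 1 / l ^ 2) / 2) := by
    have hc : IntervalIntegrable (fun x : ℝ => x - x / l ^ 2) volume 0 1 :=
      Continuous.intervalIntegrable (by fun_prop) _ _
    rw [setLIntegral_congr_fun (g := fun x => ENNReal.ofReal (x - x / l ^ 2)) measurableSet_Ioc,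
      ← ofReal_integral_eq_lintegral_ofReal]
    · rw [← intervalIntegral.integral_of_le zero_le_one, intervalIntegral.integral_sub
        (by simp) (Continuous.intervalIntegrable (by fun_prop) _ _),
        intervalIntegral.integral_div, integral_id]
      congr 1
      ring
    · exact (intervalIntegrable_iff_integrableOn_Ioc_of_le zero_le_one).1 hc
    · refine (ae_restrict_iff' measurableSet_Ioc).2 (Eventually.of_forall fun x hx => ?_)
      exact sub_nonneg.2 (div_le_self hx.1.le (one_le_pow₀ hl.le))
    · intro x hx
      have : x ≤ 1 / x := by
        rw [le_div_iff₀ hx.1]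
        nlinarith [hx.1, hx.2]
      simp only [min_eq_left this]
  have e2 : ∫⁻ x in Set.Ioc 1 l, ENNReal.ofReal (min x (1 / x) - x / l ^ 2) =
      ENNReal.ofReal (Real.log l - (1 - 1 / l ^ 2) / 2) := by
    have hc1 : IntervalIntegrable (fun x : ℝ => 1 / x) volume 1 l := by
      refine ContinuousOn.intervalIntegrable_of_Icc hl.le ?_
      refine continuousOn_const.div continuousOn_id fun x hx => ?_
      have := hx.1
      change x ≠ 0
      positivity
    have hc2 : IntervalIntegrable (fun x : ℝ => x / l ^ 2) volume 1 l :=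
      Continuous.intervalIntegrable (by fun_prop) _ _
    rw [setLIntegral_congr_fun (g := fun x => ENNReal.ofReal (1 / x - x / l ^ 2))
      measurableSet_Ioc, ← ofReal_integral_eq_lintegral_ofReal]
    · rw [← intervalIntegral.integral_of_le hl.le, intervalIntegral.integral_sub hc1 hc2,
        intervalIntegral.integral_div, integral_id, integral_one_div_of_pos one_pos hl0, div_one]
      congr 1
      field_simp
    · exact (intervalIntegrable_iff_integrableOn_Ioc_of_le hl.le).1 (hc1.sub hc2)
    · refine (ae_restrict_iff' measurableSet_Ioc).2 (Eventually.of_forall fun x hx => ?_)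
      have hx0 : 0 < x := one_pos.trans hx.1
      refine sub_nonneg.2 ?_
      rw [div_le_div_iff₀ (by positivity) hx0]
      nlinarith [hx.2]
    · intro x hx
      have hx0 : 0 < x := one_pos.trans hx.1
      have : 1 / x ≤ x := by
        rw [div_le_iff₀ hx0]
        nlinarith [hx.1]
      simp only [min_eq_right this]
  have h2 : 0 ≤ (1 - 1 / l ^ 2) / 2 := by
    have : 1 / l ^ 2 ≤ 1 := (div_le_one (by positivity)).2 (one_le_pow₀ hl.le)
    linarith
  have h3 : 0 ≤ Real.log l - (1 - 1 / l ^ 2) / 2 := by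
    have h := Real.one_sub_inv_le_log_of_pos (x := l ^ 2) (by positivity)
    rw [Real.log_pow] at h
    push_cast at h
    rw [one_div]
    linarith
  rw [e1, e2, e3, add_zero, ← ENNReal.ofReal_add h2 h3]
  congr 1
  ring

lemma measurableSet_hypSector (l : ℝ) : MeasurableSet (hypSector l) := by
  unfold hypSector
  measurability

lemma volume_hypSector {l : ℝ} (hl : 1 < l) :
    volume (hypSector l) = 2 * ENNReal.ofReal (Real.log l) := by
  have e := (volume_preserving_finTwoArrow ℝ).symm
  rw [← e.measure_preimage (measurableSet_hypSector l).nullMeasurableSet,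
    Measure.volume_eq_prod, Measure.prod_apply
      (e.measurable (measurableSet_hypSector l))]
  have hl2 : 0 < l ^ 2 := by positivity
  have hslice : ∀ x : ℝ, volume (Prod.mk x ⁻¹'
      (⇑(MeasurableEquiv.finTwoArrow (α := ℝ)).symm ⁻¹' hypSector l)) =
      (Set.Ioi 0).indicator
        (fun x => 2 * ENNReal.ofReal (min x (1 / x) - x / l ^ 2)) x := by
    intro x
    have hset : Prod.mk x ⁻¹' (⇑(MeasurableEquiv.finTwoArrow (α := ℝ)).symm ⁻¹' hypSector l) =
        {y : ℝ | 0 < x ∧ |y| ≤ x ∧ x < l ^ 2 * |y| ∧ x * |y| ≤ 1} := rfl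
    rw [hset]
    by_cases hx : 0 < x
    · rw [Set.indicator_of_mem (Set.mem_Ioi.2 hx), ← volume_abs_mem_Ioc (by positivity)]
      congr 1
      ext y
      simp only [Set.mem_ofPred_eq, le_min_iff, div_lt_iff₀' hl2, le_div_iff₀' hx]
      tauto
    · rw [Set.indicator_of_notMem (by simpa using hx)]
      simp [hx]
  simp only [hslice]
  rw [lintegral_indicator measurableSet_Ioi, lintegral_const_mul' _ _ (by simp),
    lintegral_sector hl]

/-- The linear coordinates `(u₀ - u₁ α, u₀ - u₁ β)` on the plane. -/
noncomputable def coordMap (α β : ℝ) : Plane →ₗ[ℝ] Plane :=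
  Matrix.toLin' !![1, -α; 1, -β]

lemma coordMap_zero (α β : ℝ) (u : Plane) : coordMap α β u 0 = u 0 - u 1 * α := by
  simp [coordMap, Matrix.mulVec, dotProduct, Fin.sum_univ_two]
  ring

lemma coordMap_one (α β : ℝ) (u : Plane) : coordMap α β u 1 = u 0 - u 1 * β := by
  simp [coordMap, Matrix.mulVec, dotProduct, Fin.sum_univ_two]
  ring

lemma det_coordMap (α β : ℝ) : LinearMap.det (coordMap α β) = α - β := by
  rw [coordMap, LinearMap.det_toLin', Matrix.det_fin_two_of]
  ring

/-- The lattice points of `Q` in a fundamental sector bounded by a hyperbola. -/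
def sectorPoints (Q : Set (Fin 2 → ℤ)) (α β l X : ℝ) : Set (Fin 2 → ℤ) :=
  {v | v ∈ Q ∧ 0 < (v 0 - v 1 * α : ℝ) ∧ |(v 0 - v 1 * β : ℝ)| ≤ v 0 - v 1 * α ∧
    (v 0 - v 1 * α : ℝ) < l ^ 2 * |(v 0 - v 1 * β : ℝ)| ∧
    (v 0 - v 1 * α) * |(v 0 - v 1 * β : ℝ)| ≤ X}

section Sector

variable {α β : ℝ}

lemma isBounded_coord_preimage (hαβ : α ≠ β) {S : Set Plane}
    (hS : Bornology.IsBounded S) :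
    Bornology.IsBounded (coordMap α β ⁻¹' S) := by
  have hdet : IsUnit (LinearMap.det (coordMap α β)) := by
    rw [det_coordMap]
    exact (sub_ne_zero.2 hαβ).isUnit
  let e := (LinearEquiv.ofIsUnitDet (v := Pi.basisFun ℝ (Fin 2))
    (v' := Pi.basisFun ℝ (Fin 2)) (f := coordMap α β)
      (by rwa [LinearMap.det_toMatrix])).toContinuousLinearEquiv
  have h : coordMap α β ⁻¹' S = e.symm '' S := by
    ext x
    rw [Set.mem_image]
    exact ⟨fun hx => ⟨e x, hx, e.symm_apply_apply x⟩, by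
      rintro ⟨y, hy, rfl⟩
      change e (e.symm y) ∈ S
      rwa [e.apply_symm_apply]⟩
  rw [h]
  exact e.symm.lipschitz.isBounded_image hS

lemma volume_frontier_coord_preimage (hαβ : α ≠ β) {l : ℝ} (hl : 1 < l) :
    volume (frontier (coordMap α β ⁻¹' hypSector l)) = 0 := by
  have hdet : LinearMap.det (coordMap α β) ≠ 0 := by
    rw [det_coordMap]
    exact sub_ne_zero.2 hαβ
  have hsub := (LinearMap.continuous_of_finiteDimensional
    (coordMap α β)).frontier_preimage_subset (hypSector l)
  refine measure_mono_null hsub ?_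
  rw [Measure.addHaar_preimage_linearMap volume hdet, volume_frontier_hypSector hl, mul_zero]

lemma volume_coord_preimage (hαβ : α ≠ β) {l : ℝ} (hl : 1 < l) :
    volume.real (coordMap α β ⁻¹' hypSector l) = 2 * Real.log l / |α - β| := by
  have hdet : LinearMap.det (coordMap α β) ≠ 0 := by
    rw [det_coordMap]
    exact sub_ne_zero.2 hαβ
  rw [measureReal_def, Measure.addHaar_preimage_linearMap volume hdet, volume_hypSector hl,
    det_coordMap, ENNReal.toReal_mul, ENNReal.toReal_ofReal (abs_nonneg _), ENNReal.toReal_mul,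
    ENNReal.toReal_ofReal (Real.log_nonneg hl.le), abs_inv]
  simp
  ring

lemma mem_coord_preimage_iff {l : ℝ} {n : ℕ} (hn : n ≠ 0) (v : Fin 2 → ℤ) :
    (n : ℝ)⁻¹ • latticeEmb v ∈ coordMap α β ⁻¹' hypSector l ↔
      v ∈ sectorPoints Set.univ α β l ((n : ℝ) ^ 2) := by
  have hn' : (0 : ℝ) < n := by positivity
  have e0 : coordMap α β (latticeEmb v) 0 = v 0 - v 1 * α := coordMap_zero _ _ _
  have e1 : coordMap α β (latticeEmb v) 1 = v 0 - v 1 * β := coordMap_one _ _ _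
  simp only [Set.mem_preimage, map_smul, hypSector, sectorPoints, Set.mem_ofPred_eq,
    Pi.smul_apply, smul_eq_mul, e0, e1, abs_mul, abs_inv, abs_of_pos hn', Set.mem_univ, true_and]
  refine and_congr (mul_pos_iff_of_pos_left (by positivity))
    (and_congr (mul_le_mul_iff_right₀ (by positivity)) (and_congr ?_ ?_))
  · rw [mul_left_comm]
    exact mul_lt_mul_iff_right₀ (by positivity)
  · rw [mul_mul_mul_comm, ← mul_inv, inv_mul_le_iff₀ (by positivity), mul_one, sq]

lemma hasCompactSupport_sector (hαβ : α ≠ β) (l : ℝ) :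
    HasCompactSupport ((coordMap α β ⁻¹' hypSector l).indicator (1 : Plane → ℝ)) :=
  HasCompactSupport.intro
    (isBounded_coord_preimage hαβ (isBounded_hypSector l)).isCompact_closure fun _ hx =>
      Set.indicator_of_notMem (fun h => hx (subset_closure h)) _

lemma sectorPoints_mono (Q : Set (Fin 2 → ℤ)) (α β l : ℝ) : Monotone (sectorPoints Q α β l) :=
  fun _ _ h _ hv => ⟨hv.1, hv.2.1, hv.2.2.1, hv.2.2.2.1, hv.2.2.2.2.trans h⟩

lemma finite_sectorPoints (hαβ : α ≠ β) (Q : Set (Fin 2 → ℤ)) (l X : ℝ) :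
    (sectorPoints Q α β l X).Finite := by
  obtain ⟨n, hn⟩ := exists_nat_ge (max X 1)
  have hn1 : (1 : ℝ) ≤ n := (le_max_right _ _).trans hn
  have hn0 : n ≠ 0 := by
    rintro rfl
    norm_num at hn1
  have hX : X ≤ (n : ℝ) ^ 2 := by nlinarith [(le_max_left X 1).trans hn]
  refine (finite_support_scaled (hasCompactSupport_sector hαβ l) hn0).subset fun v hv => ?_
  have hv' : v ∈ sectorPoints Set.univ α β l ((n : ℝ) ^ 2) :=
    sectorPoints_mono _ _ _ _ hX ⟨Set.mem_univ _, hv.2⟩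
  rw [← mem_coord_preimage_iff hn0] at hv'
  simp [Set.indicator_of_mem hv']

lemma latticeAvg_sector (hαβ : α ≠ β) (Q : Set (Fin 2 → ℤ)) (l : ℝ) {n : ℕ} (hn : n ≠ 0) :
    latticeAvg Q ((coordMap α β ⁻¹' hypSector l).indicator 1) n =
      (sectorPoints Q α β l ((n : ℝ) ^ 2)).ncard / (n : ℝ) ^ 2 := by
  classical
  have hfin := finite_sectorPoints hαβ Q l ((n : ℝ) ^ 2)
  have key : ∀ v, Q.indicator (fun v => (coordMap α β ⁻¹' hypSector l).indicator
      (1 : Plane → ℝ) ((n : ℝ)⁻¹ • latticeEmb v)) v =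
      (sectorPoints Q α β l ((n : ℝ) ^ 2)).indicator 1 v := by
    intro v
    have hm := mem_coord_preimage_iff (α := α) (β := β) (l := l) hn v
    simp only [Set.indicator_apply, hm, Pi.one_apply, ← ite_and]
    refine if_congr ⟨fun h => ⟨h.1, h.2.2⟩, fun h => ⟨h.1, Set.mem_univ _, h.2⟩⟩ rfl rfl
  rw [latticeAvg, tsum_congr key, tsum_eq_sum (s := hfin.toFinset) fun v hv =>
    Set.indicator_of_notMem (by simpa using hv) _, Set.ncard_eq_toFinset_card _ hfin]
  congr 1
  rw [Finset.sum_congr rfl fun v hv => Set.indicator_of_mem (hfin.mem_toFinset.1 hv) _]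
  simp

/-- The number of lattice points in growing hyperbolic sectors. -/
theorem tendsto_ncard_sectorPoints (hαβ : α ≠ β) {Q : Set (Fin 2 → ℤ)}
    {c : ℝ} (hc0 : 0 ≤ c)
    (h : ∀ φ : Plane → ℝ, Continuous φ → HasCompactSupport φ →
      Tendsto (latticeAvg Q φ) atTop (𝓝 (c * ∫ x, φ x))) {l : ℝ} (hl : 1 < l) :
    Tendsto (fun X : ℝ => ((sectorPoints Q α β l X).ncard : ℝ) / X) atTop
      (𝓝 (c * (2 * Real.log l / |α - β|))) := by
  set z : ℝ → ℝ := fun X => (sectorPoints Q α β l X).ncard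
  have hz : Monotone z := fun X Y hXY => by
    have := Set.ncard_le_ncard (sectorPoints_mono Q α β l hXY) (finite_sectorPoints hαβ Q l Y)
    exact Nat.cast_le.2 this
  have hsq : Tendsto (fun n : ℕ => z ((n : ℝ) ^ 2) / (n : ℝ) ^ 2) atTop
      (𝓝 (c * (2 * Real.log l / |α - β|))) := by
    have h1 := tendsto_latticeAvg_indicator hc0 h
      (isBounded_coord_preimage hαβ (isBounded_hypSector l))
      (volume_frontier_coord_preimage hαβ hl)
    rw [volume_coord_preimage hαβ hl] at h1
    refine h1.congr' ?_
    filter_upwards [eventually_ne_atTop 0] with n hn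
    exact latticeAvg_sector hαβ Q l hn
  have hratio : Tendsto (fun n : ℕ => ((n : ℝ) / ((n + 1 : ℕ) : ℝ)) ^ 2) atTop (𝓝 1) := by
    have := (tendsto_natCast_div_add_atTop (1 : ℝ)).pow 2
    simpa using this
  have hfl : Tendsto (fun X : ℝ => ⌊√X⌋₊) atTop atTop :=
    tendsto_nat_floor_atTop.comp Real.tendsto_sqrt_atTop
  have hlow := (hsq.mul hratio).comp hfl
  have hupp := ((hsq.comp (tendsto_add_atTop_nat 1)).div hratio one_ne_zero).comp hfl
  rw [mul_one] at hlow
  rw [div_one] at hupp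
  refine tendsto_of_tendsto_of_tendsto_of_le_of_le' hlow hupp ?_ ?_
  all_goals
    filter_upwards [eventually_ge_atTop 1] with X hX
    have hs : √X ^ 2 = X := Real.sq_sqrt (by linarith)
    have h1 : (1 : ℝ) ≤ √X := Real.one_le_sqrt.2 hX
    have hn0 : 0 < ⌊√X⌋₊ := Nat.floor_pos.2 h1
    have hn0' : (0 : ℝ) < (⌊√X⌋₊ : ℝ) := by exact_mod_cast hn0
    have hle : (⌊√X⌋₊ : ℝ) ≤ √X := Nat.floor_le (by positivity)
    have hlt : √X < (⌊√X⌋₊ : ℝ) + 1 := Nat.lt_floor_add_one _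
    have hXle : (⌊√X⌋₊ : ℝ) ^ 2 ≤ X := (pow_le_pow_left₀ hn0'.le hle 2).trans hs.le
    have hXlt : X ≤ ((⌊√X⌋₊ : ℝ) + 1) ^ 2 := hs.symm.le.trans
      (pow_le_pow_left₀ (by positivity) hlt.le 2)
    simp only [Function.comp_apply, Pi.div_apply]
  · have e : z ((⌊√X⌋₊ : ℝ) ^ 2) / (⌊√X⌋₊ : ℝ) ^ 2 *
        ((⌊√X⌋₊ : ℝ) / ((⌊√X⌋₊ + 1 : ℕ) : ℝ)) ^ 2 =
        z ((⌊√X⌋₊ : ℝ) ^ 2) / ((⌊√X⌋₊ : ℝ) + 1) ^ 2 := by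
      push_cast
      field_simp
    rw [e]
    exact div_le_div₀ (Nat.cast_nonneg _) (hz hXle) (by linarith) hXlt
  · have e : z (((⌊√X⌋₊ + 1 : ℕ) : ℝ) ^ 2) / ((⌊√X⌋₊ + 1 : ℕ) : ℝ) ^ 2 /
        ((⌊√X⌋₊ : ℝ) / ((⌊√X⌋₊ + 1 : ℕ) : ℝ)) ^ 2 =
        z (((⌊√X⌋₊ : ℝ) + 1) ^ 2) / (⌊√X⌋₊ : ℝ) ^ 2 := by
      push_cast
      field_simp
    rw [e]
    exact div_le_div₀ (Nat.cast_nonneg _) (hz hXlt) (by positivity) hXle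

end Sector

/-- The denominator of a Möbius transformation. -/
noncomputable def mobiusDen (g : SL2Z) (x : ℝ) : ℝ := g.1 1 0 * x + g.1 1 1

lemma eq_zero_of_irrational_mul {α : ℝ} (hα : Irrational α) {r s : ℚ}
    (h : (r : ℝ) * α = s) : r = 0 ∧ s = 0 := by
  have hr : r = 0 := by
    by_contra hr
    refine (hα.ratCast_mul hr) ⟨s, h.symm⟩
  subst hr
  refine ⟨rfl, ?_⟩
  simpa using h.symm

lemma mobiusDen_ne_zero (g : SL2Z) {x : ℝ} (hx : Irrational x) : mobiusDen g x ≠ 0 := by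
  intro h
  have h1 : ((g.1 1 0 : ℚ) : ℝ) * x = ((-g.1 1 1 : ℚ) : ℝ) := by
    push_cast
    rw [mobiusDen] at h
    linarith
  obtain ⟨h2, h3⟩ := eq_zero_of_irrational_mul hx h1
  have h2 : g.1 1 0 = 0 := by exact_mod_cast h2
  have h3 : g.1 1 1 = 0 := by
    have : (g.1 1 1 : ℚ) = 0 := by linarith
    exact_mod_cast this
  have := sl2z_det g
  simp [h2, h3] at this

lemma mobius_mul_den (g : SL2Z) {x : ℝ} (hx : Irrational x) :
    mobius g x * mobiusDen g x = g.1 0 0 * x + g.1 0 1 :=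
  div_mul_cancel₀ _ (mobiusDen_ne_zero g hx)

lemma mobius_eq_iff (g : SL2Z) {x y : ℝ} (hx : Irrational x) :
    mobius g x = y ↔ g.1 0 0 * x + g.1 0 1 = y * mobiusDen g x :=
  div_eq_iff (mobiusDen_ne_zero g hx)

lemma mobiusDen_mul (g h : SL2Z) {x : ℝ} (hx : Irrational x) :
    mobiusDen (g * h) x = mobiusDen g (mobius h x) * mobiusDen h x := by
  have e := mobius_mul_den h hx
  rw [show mobiusDen g (mobius h x) * mobiusDen h x =
    g.1 1 0 * (mobius h x * mobiusDen h x) + g.1 1 1 * mobiusDen h x by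
      rw [mobiusDen]; ring, e]
  simp only [mobiusDen, sl2z_mul_apply]
  push_cast
  ring

lemma mobius_mul (g h : SL2Z) {x : ℝ} (hx : Irrational x) :
    mobius (g * h) x = mobius g (mobius h x) := by
  have e := mobius_mul_den h hx
  have hd := mobiusDen_ne_zero h hx
  have hgh := mobiusDen_ne_zero (g * h) hx
  have hg : mobiusDen g (mobius h x) ≠ 0 := fun h0 =>
    hgh (by rw [mobiusDen_mul g h hx, h0, zero_mul])
  rw [mobius_eq_iff _ hx, mobiusDen_mul g h hx, ← mul_assoc,
    show mobius g (mobius h x) * mobiusDen g (mobius h x) =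
      g.1 0 0 * mobius h x + g.1 0 1 from div_mul_cancel₀ _ hg,
    add_mul, mul_assoc, e]
  simp only [mobiusDen, sl2z_mul_apply]
  push_cast
  ring

lemma mobius_one (x : ℝ) : mobius 1 x = x := by
  simp [mobius]

lemma mobius_neg (g : SL2Z) (x : ℝ) : mobius (-g) x = mobius g x := by
  have h : ∀ i j, (-g).1 i j = -(g.1 i j) := fun i j => rfl
  simp only [mobius, h]
  rw [← neg_div_neg_eq]
  push_cast
  congr 1 <;> ring

lemma mobius_transMat (k : ℤ) (x : ℝ) : mobius (transMat k) x = x + k := by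
  simp [mobius, transMat_val]

lemma mobius_inv_of_eq {g : SL2Z} {x y : ℝ} (hx : Irrational x) (h : mobius g x = y) :
    mobius g⁻¹ y = x := by
  rw [← h, ← mobius_mul _ _ hx, inv_mul_cancel, mobius_one]

lemma mobius_zpow {g : SL2Z} {x : ℝ} (hx : Irrational x) (h : mobius g x = x) (k : ℤ) :
    mobius (g ^ k) x = x := by
  induction k with
  | zero => rw [zpow_zero, mobius_one]
  | succ k ih => rw [zpow_add_one, mobius_mul _ _ hx, h, ih]
  | pred k ih => rw [zpow_sub_one, mobius_mul _ _ hx, mobius_inv_of_eq hx h, ih]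

lemma mobius_sub_mobius (g : SL2Z) {x y : ℝ} (hx : Irrational x) (hy : Irrational y) :
    (mobius g x - mobius g y) * (mobiusDen g x * mobiusDen g y) = x - y := by
  have e : (mobius g x - mobius g y) * (mobiusDen g x * mobiusDen g y) =
      mobius g x * mobiusDen g x * mobiusDen g y - mobius g y * mobiusDen g y * mobiusDen g x := by
    ring
  rw [e, mobius_mul_den g hx, mobius_mul_den g hy, mobiusDen, mobiusDen]
  linear_combination (x - y) * sl2z_det_real g

/-- The linear form `u ↦ u₀ - u₁ x`. -/
noncomputable def linForm (x : ℝ) (u : Fin 2 → ℤ) : ℝ := u 0 - u 1 * x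

lemma int_smul_zero (g : SL2Z) (v : Fin 2 → ℤ) :
    (g • v) 0 = g.1 0 0 * v 0 + g.1 0 1 * v 1 := by
  simp [Matrix.SpecialLinearGroup.smul_def, Matrix.mulVec, dotProduct, Fin.sum_univ_two]

lemma int_smul_one (g : SL2Z) (v : Fin 2 → ℤ) :
    (g • v) 1 = g.1 1 0 * v 0 + g.1 1 1 * v 1 := by
  simp [Matrix.SpecialLinearGroup.smul_def, Matrix.mulVec, dotProduct, Fin.sum_univ_two]

lemma int_neg_smul (g : SL2Z) (v : Fin 2 → ℤ) : (-g) • v = -(g • v) := by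
  have h : ∀ i j, (-g).1 i j = -(g.1 i j) := fun i j => rfl
  ext i
  fin_cases i
  · simp [int_smul_zero, h]
    ring
  · simp [int_smul_one, h]
    ring

lemma linForm_neg (x : ℝ) (u : Fin 2 → ℤ) : linForm x (-u) = -linForm x u := by
  simp [linForm]
  ring

lemma linForm_smul (g : SL2Z) (u : Fin 2 → ℤ) {x y : ℝ} (hx : Irrational x)
    (h : mobius g x = y) : linForm y (g • u) * mobiusDen g x = linForm x u := by
  have e := (mobius_eq_iff g hx).1 h
  rw [show linForm y (g • u) * mobiusDen g x =
    ((g • u) 0 : ℝ) * mobiusDen g x - (g • u) 1 * (y * mobiusDen g x) by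
      rw [linForm]; ring, ← e, int_smul_zero, int_smul_one, mobiusDen, linForm]
  push_cast
  linear_combination (u 0 - u 1 * x) * sl2z_det_real g

lemma linForm_firstCol (k : SL2Z) (x : ℝ) : linForm x (firstCol k) = mobiusDen k⁻¹ x := by
  have h : (k⁻¹).1 = !![k.1 1 1, -k.1 0 1; -k.1 1 0, k.1 0 0] := by
    rw [Matrix.SpecialLinearGroup.SL2_inv_expl]
    rfl
  rw [linForm, mobiusDen, h]
  simp [firstCol]
  ring

lemma linForm_firstCol_ne_zero (k : SL2Z) {x : ℝ} (hx : Irrational x) :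
    linForm x (firstCol k) ≠ 0 := by
  rw [linForm_firstCol]
  exact mobiusDen_ne_zero _ hx

/-- A matrix fixing a primitive vector and an irrational number is trivial. -/
lemma eq_of_smul_firstCol_eq {h h' k : SL2Z} {x : ℝ} (hx : Irrational x)
    (hu : h • firstCol k = h' • firstCol k) (hm : mobius h x = mobius h' x) : h = h' := by
  rw [← firstCol_mul, ← firstCol_mul] at hu
  obtain ⟨j, hj⟩ := firstCol_eq_iff.1 hu
  have hm' : mobius (k⁻¹ * h'⁻¹ * h) x = mobius (k⁻¹) x := by
    rw [mobius_mul _ _ hx, hm, ← mobius_mul _ _ hx, inv_mul_cancel_right]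
  have e : k⁻¹ * h'⁻¹ * h = transMat (-j) * k⁻¹ := by
    rw [transMat_neg, ← mul_inv_rev, hj]
    group
  rw [e, mobius_mul _ _ hx, mobius_transMat] at hm'
  have hj0 : j = 0 := by
    have : ((-j : ℤ) : ℝ) = 0 := by linarith
    have := Int.cast_eq_zero.1 this
    omega
  rw [hj0, transMat_zero, mul_one] at hj
  exact (mul_right_cancel hj).symm

/-- The two conjugates of a quadratic irrational of trace `a`. -/
noncomputable def conjPt (α : ℝ) (a : ℚ) (e : Bool) : ℝ := cond e (a - α) α

/-- The condition that `g` stabilises the pair of conjugates. -/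
def StabPair (α : ℝ) (a : ℚ) (g : SL2Z) : Prop :=
  (mobius g α = α ∧ mobius g ((a : ℝ) - α) = (a : ℝ) - α) ∨
    (mobius g α = (a : ℝ) - α ∧ mobius g ((a : ℝ) - α) = α)

lemma irrational_conj {α : ℝ} (hα : Irrational α) (a : ℚ) : Irrational ((a : ℝ) - α) :=
  hα.ratCast_sub a

lemma conj_quad {α : ℝ} {a b : ℚ} (h : α ^ 2 = (a : ℝ) * α + b) :
    ((a : ℝ) - α) ^ 2 = (a : ℝ) * (a - α) + b := by
  linear_combination h

lemma ne_conj {α : ℝ} (hα : Irrational α) (a : ℚ) : α ≠ (a : ℝ) - α := by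
  intro h
  have := eq_zero_of_irrational_mul hα (r := 2) (s := a) (by push_cast; linarith)
  exact two_ne_zero this.1

section Conj

variable {α : ℝ} {a b : ℚ}

lemma irrational_conjPt (hα : Irrational α) (e : Bool) : Irrational (conjPt α a e) := by
  cases e
  · exact hα
  · exact irrational_conj hα a

lemma conjPt_injective (hα : Irrational α) : Function.Injective (conjPt α a) := by
  intro e e' h
  cases e <;> cases e'
  · rfl
  · exact absurd h (ne_conj hα a)
  · exact absurd h.symm (ne_conj hα a)
  · rfl

lemma mobius_conj_of_fix (hα : Irrational α) (hq : α ^ 2 = (a : ℝ) * α + b) {g : SL2Z}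
    (h : mobius g α = α) : mobius g ((a : ℝ) - α) = a - α := by
  rw [mobius_eq_iff g hα, mobiusDen] at h
  rw [mobius_eq_iff g (irrational_conj hα a), mobiusDen]
  obtain ⟨h1, h2⟩ := eq_zero_of_irrational_mul hα (r := g.1 0 0 - g.1 1 0 * a - g.1 1 1)
    (s := g.1 1 0 * b - g.1 0 1) (by push_cast; linear_combination h + (g.1 1 0 : ℝ) * hq)
  have h1 : (g.1 0 0 - g.1 1 0 * a - g.1 1 1 : ℝ) = 0 := by exact_mod_cast h1
  have h2 : (g.1 1 0 * b - g.1 0 1 : ℝ) = 0 := by exact_mod_cast h2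
  linear_combination (a - α) * h1 - h2 - (g.1 1 0 : ℝ) * hq

lemma mobius_conj_of_swap (hα : Irrational α) (hq : α ^ 2 = (a : ℝ) * α + b) {g : SL2Z}
    (h : mobius g α = a - α) : mobius g ((a : ℝ) - α) = α := by
  rw [mobius_eq_iff g hα, mobiusDen] at h
  rw [mobius_eq_iff g (irrational_conj hα a), mobiusDen]
  obtain ⟨h1, h2⟩ := eq_zero_of_irrational_mul hα (r := g.1 0 0 + g.1 1 1)
    (s := a * g.1 1 1 - g.1 1 0 * b - g.1 0 1)
    (by push_cast; linear_combination h - (g.1 1 0 : ℝ) * hq)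
  have h1 : (g.1 0 0 + g.1 1 1 : ℝ) = 0 := by exact_mod_cast h1
  have h2 : (a * g.1 1 1 - g.1 1 0 * b - g.1 0 1 : ℝ) = 0 := by exact_mod_cast h2
  linear_combination (a - α) * h1 - h2 + (g.1 1 0 : ℝ) * hq

lemma stabPair_of_eq (hα : Irrational α) (hq : α ^ 2 = (a : ℝ) * α + b) {g : SL2Z} {e e' : Bool}
    (h : mobius g (conjPt α a e) = conjPt α a e') : StabPair α a g := by
  have hα' := irrational_conj hα a
  have hq' := conj_quad hq
  cases e <;> cases e'
  · exact Or.inl ⟨h, mobius_conj_of_fix hα hq h⟩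
  · exact Or.inr ⟨h, mobius_conj_of_swap hα hq h⟩
  · have := mobius_conj_of_swap hα' hq' (g := g) (by rw [sub_sub_cancel]; exact h)
    rw [sub_sub_cancel] at this
    exact Or.inr ⟨this, h⟩
  · have := mobius_conj_of_fix hα' hq' (g := g) h
    rw [sub_sub_cancel] at this
    exact Or.inl ⟨this, h⟩

lemma StabPair.exists_image {g : SL2Z} (h : StabPair α a g) (e : Bool) :
    ∃ e', mobius g (conjPt α a e) = conjPt α a e' := by
  rcases h with h | h <;> cases e
  · exact ⟨false, h.1⟩
  · exact ⟨true, h.2⟩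
  · exact ⟨true, h.1⟩
  · exact ⟨false, h.2⟩

lemma StabPair.inv (hα : Irrational α) (hq : α ^ 2 = (a : ℝ) * α + b) {g : SL2Z}
    (h : StabPair α a g) : StabPair α a g⁻¹ := by
  obtain ⟨e, he⟩ := h.exists_image false
  exact stabPair_of_eq hα hq (mobius_inv_of_eq (irrational_conjPt hα _) he)

/-- The product of the two linear forms is preserved up to sign by the stabiliser of the pair. -/
lemma StabPair.abs_linForm_mul (hα : Irrational α) {g : SL2Z} (h : StabPair α a g)
    (u : Fin 2 → ℤ) :
    |linForm α (g • u) * linForm (a - α) (g • u)| = |linForm α u * linForm (a - α) u| := by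
  have hα' := irrational_conj hα a
  have hne : α - (a - α) ≠ 0 := sub_ne_zero.2 (ne_conj hα a)
  have hs := mobius_sub_mobius g hα hα'
  have hd : |mobiusDen g α * mobiusDen g (a - α)| = 1 := by
    rcases h with h | h
    · rw [h.1, h.2] at hs
      have : mobiusDen g α * mobiusDen g (a - α) = 1 := mul_left_cancel₀ hne (by linarith)
      simp [this]
    · rw [h.1, h.2] at hs
      have : mobiusDen g α * mobiusDen g (a - α) = -1 := mul_left_cancel₀ hne (by linarith)
      simp [this]
  have key : |linForm α (g • u) * linForm (a - α) (g • u)| *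
      |mobiusDen g α * mobiusDen g (a - α)| = |linForm α u * linForm (a - α) u| := by
    rw [← abs_mul]
    congr 1
    rcases h with h | h
    · rw [← linForm_smul g u hα h.1, ← linForm_smul g u hα' h.2]
      ring
    · rw [← linForm_smul g u hα h.1, ← linForm_smul g u hα' h.2]
      ring
  rwa [hd, mul_one] at key

end Conj

/-- Twice the larger eigenvalue is `t + √(t² - 4)`, with `t` the absolute value of the trace. -/
noncomputable def eigenvalueOfTrace (t : ℝ) : ℝ := (|t| + √(t ^ 2 - 4)) / 2

lemma eigenvalueOfTrace_gt_one {t : ℝ} (ht : 2 < |t|) : 1 < eigenvalueOfTrace t := by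
  rw [eigenvalueOfTrace]
  linarith [Real.sqrt_nonneg (t ^ 2 - 4)]

lemma eigenvalueOfTrace_sq {t : ℝ} (ht : 2 < |t|) :
    eigenvalueOfTrace t ^ 2 - |t| * eigenvalueOfTrace t + 1 = 0 := by
  have h : √(t ^ 2 - 4) ^ 2 = t ^ 2 - 4 := Real.sq_sqrt (by nlinarith [sq_abs t])
  rw [eigenvalueOfTrace]
  linear_combination h / 4 + (-1 / 4 : ℝ) * sq_abs t

lemma sq_eq_of_root {t x : ℝ} (ht : 2 < |t|) (hx : x ^ 2 - t * x + 1 = 0) :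
    x ^ 2 = eigenvalueOfTrace t ^ 2 ∨ x ^ 2 = (eigenvalueOfTrace t ^ 2)⁻¹ := by
  have hl := eigenvalueOfTrace_sq ht
  have hl1 := eigenvalueOfTrace_gt_one ht
  set l := eigenvalueOfTrace t
  have h1 : |t| * |x| = x ^ 2 + 1 := by
    rw [← abs_mul, show t * x = x ^ 2 + 1 by linarith, abs_of_pos (by positivity)]
  have h2 : (|x| - l) * (|x| * l - 1) = 0 := by
    linear_combination (|x|) * (-hl) - l * h1 + l * sq_abs x
  rcases mul_eq_zero.1 h2 with h | h
  · left
    rw [← sq_abs, sub_eq_zero.1 h]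
  · right
    have : |x| * l = 1 := by linarith
    rw [← sq_abs, ← inv_pow]
    congr 1
    exact eq_inv_of_mul_eq_one_left this

/-- The quotient of the absolute values of the two linear forms. -/
noncomputable def formRatio (α β : ℝ) (u : Fin 2 → ℤ) : ℝ := |linForm α u| / |linForm β u|

section Hyperbolic

variable {α : ℝ} {a b : ℚ} {g : SL2Z}

lemma mobiusDen_mul_conj (hα : Irrational α) (hq : α ^ 2 = (a : ℝ) * α + b)
    (hg : mobius g α = α) : mobiusDen g α * mobiusDen g (a - α) = 1 := by
  have hs := mobius_sub_mobius g hα (irrational_conj hα a)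
  rw [hg, mobius_conj_of_fix hα hq hg] at hs
  exact mul_left_cancel₀ (sub_ne_zero.2 (ne_conj hα a)) (by linarith)

lemma mobiusDen_root (hα : Irrational α) (hg : mobius g α = α) :
    mobiusDen g α ^ 2 - ((g.1 0 0 + g.1 1 1 : ℤ) : ℝ) * mobiusDen g α + 1 = 0 := by
  have h := (mobius_eq_iff g hα).1 hg
  rw [mobiusDen] at h ⊢
  push_cast
  linear_combination -(g.1 1 0 : ℝ) * h + sl2z_det_real g * (-1)

lemma formRatio_smul (hα : Irrational α) (hq : α ^ 2 = (a : ℝ) * α + b)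
    (hg : mobius g α = α) (u : Fin 2 → ℤ) :
    formRatio α (a - α) (g • u) = formRatio α (a - α) u * mobiusDen g (a - α) ^ 2 := by
  have hα' := irrational_conj hα a
  have hd := mobiusDen_mul_conj hα hq hg
  have h1 := mobiusDen_ne_zero g hα
  have h2 := mobiusDen_ne_zero g hα'
  rw [formRatio, formRatio, ← linForm_smul g u hα hg,
    ← linForm_smul g u hα' (mobius_conj_of_fix hα hq hg), abs_mul, abs_mul, ← sq_abs]
  have hd' : |mobiusDen g α| * |mobiusDen g (a - α)| = 1 := by rw [← abs_mul, hd, abs_one]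
  have h2' : |mobiusDen g (a - α)| ≠ 0 := abs_ne_zero.2 h2
  rcases eq_or_ne (|linForm (a - α) (g • u)|) 0 with h0 | h0
  · simp [h0]
  · field_simp
    linear_combination (-|linForm α (g • u)|) * hd'

lemma formRatio_zpow_smul (hα : Irrational α) (hq : α ^ 2 = (a : ℝ) * α + b)
    (hg : mobius g α = α) (k : ℤ) (u : Fin 2 → ℤ) :
    formRatio α (a - α) (g ^ k • u) =
      formRatio α (a - α) u * (mobiusDen g (a - α) ^ 2) ^ k := by
  have h2 : mobiusDen g (a - α) ^ 2 ≠ 0 :=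
    pow_ne_zero 2 (mobiusDen_ne_zero g (irrational_conj hα a))
  induction k generalizing u with
  | zero => simp
  | succ k ih =>
    rw [zpow_add_one, mul_smul, ih, formRatio_smul hα hq hg, zpow_add_one₀ h2]
    ring
  | pred k ih =>
    have h := formRatio_smul hα hq hg (g⁻¹ • u)
    rw [smul_inv_smul] at h
    rw [zpow_sub_one, mul_smul, ih, zpow_sub_one₀ h2, h, mul_assoc,
      mul_comm (mobiusDen g (a - α) ^ 2), mul_assoc, inv_mul_cancel₀ h2, mul_one]

end Hyperbolic

/-- The subgroup `{± g ^ k}`. -/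
def signedZPowers (g : SL2Z) : Subgroup SL2Z where
  carrier := {h | ∃ k : ℤ, h = g ^ k ∨ h = -(g ^ k)}
  one_mem' := ⟨0, Or.inl (zpow_zero g).symm⟩
  mul_mem' := by
    rintro _ _ ⟨k, rfl | rfl⟩ ⟨l, rfl | rfl⟩
    · exact ⟨k + l, Or.inl (zpow_add g k l).symm⟩
    · exact ⟨k + l, Or.inr (by rw [zpow_add, mul_neg])⟩
    · exact ⟨k + l, Or.inr (by rw [zpow_add, neg_mul])⟩
    · exact ⟨k + l, Or.inl (by rw [zpow_add, neg_mul_neg])⟩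
  inv_mem' := by
    rintro _ ⟨k, rfl | rfl⟩
    · exact ⟨-k, Or.inl (zpow_neg g k).symm⟩
    · exact ⟨-k, Or.inr (inv_eq_of_mul_eq_one_right (by
        rw [neg_mul_neg, zpow_neg, mul_inv_cancel]))⟩

lemma signedZPowers_le {G : Subgroup SL2Z} (hneg : (-1 : SL2Z) ∈ G) {g : SL2Z} (hg : g ∈ G) :
    signedZPowers g ≤ G := by
  rintro _ ⟨k, rfl | rfl⟩
  · exact G.zpow_mem hg k
  · rw [← neg_one_mul]
    exact G.mul_mem hneg (G.zpow_mem hg k)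

lemma inv_mul_mem_signedZPowers_iff {g x y : SL2Z} :
    x⁻¹ * y ∈ signedZPowers g ↔ ∃ k : ℤ, y = x * g ^ k ∨ y = -(x * g ^ k) := by
  refine exists_congr fun k => ?_
  rw [inv_mul_eq_iff_eq_mul, inv_mul_eq_iff_eq_mul, mul_neg]

lemma mobius_of_mem_signedZPowers {g h : SL2Z} (hh : h ∈ signedZPowers g) {x : ℝ}
    (hx : Irrational x) (hg : mobius g x = x) : mobius h x = x := by
  obtain ⟨k, rfl | rfl⟩ := hh
  · exact mobius_zpow hx hg k
  · rw [mobius_neg, mobius_zpow hx hg k]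

lemma exists_mul_zpow_mem {M L r : ℝ} (hL : 1 < L) (hM : M = L ∨ M = L⁻¹) (hr : 0 < r) :
    ∃ k : ℤ, 1 ≤ r * M ^ k ∧ r * M ^ k < L := by
  have hL0 : 0 < L := by linarith
  obtain ⟨n, h1, h2⟩ := exists_mem_Ico_zpow hr hL
  have key : 1 ≤ r * L ^ (-n) ∧ r * L ^ (-n) < L := by
    rw [zpow_neg, ← div_eq_mul_inv, one_le_div (zpow_pos hL0 n), div_lt_iff₀ (zpow_pos hL0 n),
      mul_comm, ← zpow_add_one₀ hL0.ne']
    exact ⟨h1, h2⟩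
  rcases hM with rfl | rfl
  · exact ⟨-n, key⟩
  · exact ⟨n, by rwa [inv_zpow']⟩

lemma eq_zero_of_mul_zpow_mem {M L r : ℝ} (hL : 1 < L) (hM : M = L ∨ M = L⁻¹) (h1 : 1 ≤ r)
    (h2 : r < L) {k : ℤ} (h3 : 1 ≤ r * M ^ k) (h4 : r * M ^ k < L) : k = 0 := by
  have hL0 : 0 < L := by linarith
  suffices H : ∀ j : ℤ, 1 ≤ r * L ^ j → r * L ^ j < L → j = 0 by
    rcases hM with rfl | rfl
    · exact H k h3 h4
    · rw [inv_zpow'] at h3 h4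
      exact neg_eq_zero.1 (H _ h3 h4)
  intro j h3 h4
  have hj := zpow_pos hL0 j
  have u1 : L ^ j < L ^ (1 : ℤ) := by
    rw [zpow_one]
    nlinarith
  have u2 : L ^ (-1 : ℤ) < L ^ j := by
    rw [zpow_neg_one, inv_lt_iff_one_lt_mul₀ hL0]
    nlinarith
  have := (zpow_lt_zpow_iff_right₀ hL).1 u1
  have := (zpow_lt_zpow_iff_right₀ hL).1 u2
  omega

/-- A fundamental sector for the action of a hyperbolic element with fixed points `α`, `β`. -/
def InSector (α β l : ℝ) (u : Fin 2 → ℤ) : Prop :=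
  0 < linForm α u ∧ |linForm β u| ≤ linForm α u ∧ linForm α u < l ^ 2 * |linForm β u|

lemma inSector_iff {α β l : ℝ} {u : Fin 2 → ℤ} (hβ : linForm β u ≠ 0) :
    InSector α β l u ↔ 0 < linForm α u ∧ 1 ≤ formRatio α β u ∧ formRatio α β u < l ^ 2 := by
  refine and_congr_right fun h0 => ?_
  rw [formRatio, abs_of_pos h0, one_le_div (abs_pos.2 hβ), div_lt_iff₀ (abs_pos.2 hβ)]

lemma formRatio_neg (α β : ℝ) (u : Fin 2 → ℤ) : formRatio α β (-u) = formRatio α β u := by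
  simp only [formRatio, linForm_neg, abs_neg]

section Hyperbolic

variable {α : ℝ} {a b : ℚ} {g : SL2Z}

lemma mobiusDen_sq_eq (hα : Irrational α) (hq : α ^ 2 = (a : ℝ) * α + b) (hg : mobius g α = α)
    {t : ℝ} (ht : ((g.1 0 0 + g.1 1 1 : ℤ) : ℝ) = t) (ht2 : 2 < |t|) :
    mobiusDen g (a - α) ^ 2 = eigenvalueOfTrace t ^ 2 ∨
      mobiusDen g (a - α) ^ 2 = (eigenvalueOfTrace t ^ 2)⁻¹ := by
  refine sq_eq_of_root ht2 ?_
  rw [← ht]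
  exact mobiusDen_root (irrational_conj hα a) (mobius_conj_of_fix hα hq hg)

lemma exists_inSector (hα : Irrational α) (hq : α ^ 2 = (a : ℝ) * α + b) (hg : mobius g α = α)
    {t : ℝ} (ht : ((g.1 0 0 + g.1 1 1 : ℤ) : ℝ) = t) (ht2 : 2 < |t|) (k : SL2Z) :
    ∃ h ∈ signedZPowers g, InSector α (a - α) (eigenvalueOfTrace t) (h • firstCol k) := by
  have hα' := irrational_conj hα a
  have hl := eigenvalueOfTrace_gt_one ht2
  have hL : 1 < eigenvalueOfTrace t ^ 2 := one_lt_pow₀ hl two_ne_zero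
  have hr : 0 < formRatio α (a - α) (firstCol k) :=
    div_pos (abs_pos.2 (linForm_firstCol_ne_zero k hα))
      (abs_pos.2 (linForm_firstCol_ne_zero k hα'))
  obtain ⟨n, h1, h2⟩ := exists_mul_zpow_mem hL (mobiusDen_sq_eq hα hq hg ht ht2) hr
  rw [← formRatio_zpow_smul hα hq hg] at h1 h2
  have hne (x : ℝ) (hx : Irrational x) : linForm x (g ^ n • firstCol k) ≠ 0 := by
    rw [← firstCol_mul]
    exact linForm_firstCol_ne_zero _ hx
  rcases (hne α hα).lt_or_gt with h | h
  · refine ⟨-(g ^ n), ⟨n, Or.inr rfl⟩, ?_⟩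
    rw [int_neg_smul, inSector_iff (by rw [linForm_neg]; exact neg_ne_zero.2 (hne _ hα')),
      formRatio_neg, linForm_neg]
    exact ⟨neg_pos.2 h, h1, h2⟩
  · exact ⟨g ^ n, ⟨n, Or.inl rfl⟩, (inSector_iff (hne _ hα')).2 ⟨h, h1, h2⟩⟩

lemma eq_one_of_inSector (hα : Irrational α) (hq : α ^ 2 = (a : ℝ) * α + b)
    (hg : mobius g α = α) {t : ℝ} (ht : ((g.1 0 0 + g.1 1 1 : ℤ) : ℝ) = t) (ht2 : 2 < |t|)
    {k h : SL2Z} (hh : h ∈ signedZPowers g)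
    (h1 : InSector α (a - α) (eigenvalueOfTrace t) (firstCol k))
    (h2 : InSector α (a - α) (eigenvalueOfTrace t) (h • firstCol k)) : h = 1 := by
  have hα' := irrational_conj hα a
  have hl := eigenvalueOfTrace_gt_one ht2
  have hL : 1 < eigenvalueOfTrace t ^ 2 := one_lt_pow₀ hl two_ne_zero
  have hne : linForm (a - α) (h • firstCol k) ≠ 0 := by
    rw [← firstCol_mul]
    exact linForm_firstCol_ne_zero _ hα'
  obtain ⟨p1, r1, s1⟩ := (inSector_iff (linForm_firstCol_ne_zero k hα')).1 h1
  obtain ⟨p2, r2, s2⟩ := (inSector_iff hne).1 h2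
  obtain ⟨n, hn⟩ := hh
  have hR : formRatio α (a - α) (h • firstCol k) = formRatio α (a - α) (g ^ n • firstCol k) := by
    rcases hn with rfl | rfl
    · rfl
    · rw [int_neg_smul, formRatio_neg]
  rw [hR, formRatio_zpow_smul hα hq hg] at r2 s2
  have hn0 := eq_zero_of_mul_zpow_mem hL (mobiusDen_sq_eq hα hq hg ht ht2) r1 s1 r2 s2
  rcases hn with rfl | rfl
  · rw [hn0, zpow_zero]
  · rw [int_neg_smul, linForm_neg, hn0, zpow_zero, one_smul] at p2
    linarith

end Hyperbolic

section Counting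

variable {α : ℝ} {a b : ℚ} {G : Subgroup SL2Z} {q : ℕ}

/-- The class modulo translations by `q` of the image of a conjugate by `k⁻¹`. -/
noncomputable def transClass (α : ℝ) (a : ℚ) (q : ℕ) (k : SL2Z) (e : Bool) : AddCircle (q : ℝ) :=
  (mobius k⁻¹ (conjPt α a e) : ℝ)

lemma exists_of_transClass_eq (hα : Irrational α) (hq : α ^ 2 = (a : ℝ) * α + b)
    (hqG : transMat (q : ℤ) ∈ G) {k k' : SL2Z} (hk : k ∈ G) (hk' : k' ∈ G) {e e' : Bool}
    (h : transClass α a q k e = transClass α a q k' e') :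
    ∃ h ∈ G, StabPair α a h ∧ h • firstCol k = firstCol k' ∧
      mobius h (conjPt α a e) = conjPt α a e' := by
  rw [transClass, transClass, QuotientAddGroup.eq, AddSubgroup.mem_zmultiples_iff] at h
  obtain ⟨m, hm⟩ := h
  have he := irrational_conjPt (a := a) hα e
  have he' := irrational_conjPt (a := a) hα e'
  have key : mobius (k' * transMat (q * m) * k⁻¹) (conjPt α a e) = conjPt α a e' := by
    have h1 : mobius (transMat (q * m) * k⁻¹) (conjPt α a e) = mobius k'⁻¹ (conjPt α a e') := by
      rw [mobius_mul _ _ he, mobius_transMat]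
      rw [zsmul_eq_mul] at hm
      push_cast
      linarith
    rw [mul_assoc, mobius_mul _ _ he, h1, ← mobius_mul _ _ he', mul_inv_cancel, mobius_one]
  refine ⟨_, G.mul_mem (G.mul_mem hk' (transMat_mul_mem hqG m)) (G.inv_mem hk),
    stabPair_of_eq hα hq key, ?_, key⟩
  rw [← firstCol_mul, inv_mul_cancel_right, firstCol_mul_transMat]

lemma transClass_eq (hα : Irrational α) (hq0 : 0 < q) (hqG : transMat (q : ℤ) ∈ G)
    (hqmin : ∀ q' : ℕ, 0 < q' → transMat (q' : ℤ) ∈ G → q ≤ q')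
    {h k k' : SL2Z} (hh : h ∈ G) (hk : k ∈ G) (hk' : k' ∈ G) {e e' : Bool}
    (hu : h • firstCol k = firstCol k') (hm : mobius h (conjPt α a e) = conjPt α a e') :
    transClass α a q k e = transClass α a q k' e' := by
  rw [← firstCol_mul] at hu
  obtain ⟨j, rfl⟩ := firstCol_eq_iff.1 hu
  have hj : transMat j ∈ G := by
    have := G.mul_mem (G.inv_mem (G.mul_mem hh hk)) hk'
    rwa [inv_mul_cancel_left] at this
  obtain ⟨m, rfl⟩ := (transMat_mem_iff hq0 hqG hqmin j).1 hj
  have he := irrational_conjPt (a := a) hα e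
  have he' := irrational_conjPt (a := a) hα e'
  rw [transClass, transClass, QuotientAddGroup.eq, AddSubgroup.mem_zmultiples_iff]
  refine ⟨-m, ?_⟩
  have e1 : (h * k * transMat (q * m))⁻¹ = transMat (-(q * m)) * k⁻¹ * h⁻¹ := by
    rw [transMat_neg]
    group
  have hinv := mobius_inv_of_eq he hm
  rw [e1, mobius_mul _ _ he', hinv, mobius_mul _ _ he, mobius_transMat, zsmul_eq_mul]
  push_cast
  ring

lemma two_div_le_iff (hα : Irrational α) (g : SL2Z) (s : ℝ) :
    2 / |mobius g α - mobius g ((a : ℝ) - α)| ≤ s ↔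
      |linForm α (firstCol g⁻¹) * linForm (a - α) (firstCol g⁻¹)| ≤
        s * |α - (a - α)| / 2 := by
  have hα' := irrational_conj hα a
  have hs := congrArg abs (mobius_sub_mobius g hα hα')
  rw [abs_mul] at hs
  have h0 : 0 < |α - (a - α)| := abs_pos.2 (sub_ne_zero.2 (ne_conj hα a))
  have h1 : 0 < |mobiusDen g α * mobiusDen g (a - α)| :=
    abs_pos.2 (mul_ne_zero (mobiusDen_ne_zero g hα) (mobiusDen_ne_zero g hα'))
  have h2 : 0 < |mobius g α - mobius g ((a : ℝ) - α)| := by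
    by_contra hc
    have : |mobius g α - mobius g ((a : ℝ) - α)| = 0 :=
      le_antisymm (not_lt.1 hc) (abs_nonneg _)
    rw [this, zero_mul] at hs
    exact h0.ne hs
  rw [linForm_firstCol, linForm_firstCol, inv_inv, div_le_iff₀ h2, le_div_iff₀ two_pos, ← hs,
    ← mul_assoc, mul_comm _ (2 : ℝ)]
  exact (mul_le_mul_iff_of_pos_right h1).symm

/-- The index of `± g₀ ^ ℤ` in the stabiliser counts the elements of the stabiliser moving a given
primitive vector into the sector. -/
lemma card_stab_quot (hα : Irrational α) (hq : α ^ 2 = (a : ℝ) * α + b)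
    (hneg : (-1 : SL2Z) ∈ G) {g₀ : SL2Z} (hg₀ : g₀ ∈ G) (hfix : mobius g₀ α = α)
    {t : ℝ} (ht : ((g₀.1 0 0 + g₀.1 1 1 : ℤ) : ℝ) = t) (ht2 : 2 < |t|) (k : SL2Z) :
    Nat.card (Quot (fun g g' : {g : SL2Z // g ∈ G ∧ StabPair α a g} =>
        ∃ k : ℤ, (g' : SL2Z) = (g : SL2Z) * g₀ ^ k ∨ (g' : SL2Z) = -((g : SL2Z) * g₀ ^ k))) =
      {h : SL2Z | (h ∈ G ∧ StabPair α a h) ∧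
        InSector α (a - α) (eigenvalueOfTrace t) (h • firstCol k)}.ncard := by
  rw [← Nat.card_coe_set_eq]
  symm
  simp_rw [← inv_mul_mem_signedZPowers_iff]
  set r := fun g g' : {g : SL2Z // g ∈ G ∧ StabPair α a g} =>
    (g : SL2Z)⁻¹ * (g' : SL2Z) ∈ signedZPowers g₀ with hr
  have hequiv : Equivalence r :=
    { refl := fun x => by
        simp only [hr, inv_mul_cancel]
        exact (signedZPowers g₀).one_mem
      symm := fun {x y} h => by
        have := (signedZPowers g₀).inv_mem h
        rwa [mul_inv_rev, inv_inv] at this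
      trans := fun {x y z} h h' => by
        have := (signedZPowers g₀).mul_mem h h'
        rwa [mul_assoc, mul_inv_cancel_left] at this }
  refine Nat.card_congr (Equiv.ofBijective
    (fun h => Quot.mk r ⟨h.1⁻¹, G.inv_mem h.2.1.1, h.2.1.2.inv hα hq⟩) ⟨?_, ?_⟩)
  · rintro ⟨h, hG, hs⟩ ⟨h', hG', hs'⟩ heq
    have hrel := hequiv.eqvGen_iff.1 (Quot.eqvGen_exact heq)
    simp only [hr, inv_inv] at hrel
    have hrel' := (signedZPowers g₀).inv_mem hrel
    rw [mul_inv_rev, inv_inv] at hrel'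
    have := eq_one_of_inSector hα hq hfix ht ht2 (k := h * k) hrel'
      (by rw [firstCol_mul]; exact hs) (by rw [← firstCol_mul]; simpa [firstCol_mul] using hs')
    exact Subtype.ext (mul_inv_eq_one.1 this).symm
  · rintro ⟨g, hgG, hgs⟩
    obtain ⟨h, hh, hsec⟩ := exists_inSector hα hq hfix ht ht2 (g⁻¹ * k)
    obtain ⟨e, he⟩ := (hgs.inv hα hq).exists_image false
    have hse : StabPair α a (h * g⁻¹) := by
      refine stabPair_of_eq hα hq (e := false) (e' := e) ?_
      rw [mobius_mul _ _ (irrational_conjPt hα _), he]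
      refine mobius_of_mem_signedZPowers hh (irrational_conjPt hα _) ?_
      cases e
      · exact hfix
      · exact mobius_conj_of_fix hα hq hfix
    refine ⟨⟨h * g⁻¹, ⟨G.mul_mem (signedZPowers_le hneg hg₀ hh) (G.inv_mem hgG), hse⟩, ?_⟩, ?_⟩
    · rwa [firstCol_mul, ← mul_smul] at hsec
    · refine (Quot.sound ?_).symm
      simp only [hr, mul_inv_rev, inv_inv, inv_mul_cancel_left]
      exact (signedZPowers g₀).inv_mem hh

end Counting

section Counting

variable {α : ℝ} {a b : ℚ} {G : Subgroup SL2Z} {q : ℕ}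

/-- The primitive vectors of the orbit of the first basis vector in the sector. -/
noncomputable def orbitPoints (G : Subgroup SL2Z) (α β l X : ℝ) : Set (Fin 2 → ℤ) :=
  sectorPoints (cosetCols ((1 : SL2Z) : SL2Z ⧸ G)) α β l X

lemma mem_cosetCols_one {v : Fin 2 → ℤ} :
    v ∈ cosetCols ((1 : SL2Z) : SL2Z ⧸ G) ↔ ∃ k ∈ G, firstCol k = v := by
  refine exists_congr fun k => and_congr_left fun _ => ?_
  rw [QuotientGroup.eq, mul_one, inv_mem_iff]

lemma mem_orbitPoints {α β l X : ℝ} {v : Fin 2 → ℤ} :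
    v ∈ orbitPoints G α β l X ↔ (∃ k ∈ G, firstCol k = v) ∧ InSector α β l v ∧
      |linForm α v * linForm β v| ≤ X := by
  rw [← mem_cosetCols_one]
  have h (h0 : 0 < linForm α v) : |linForm α v * linForm β v| = linForm α v * |linForm β v| := by
    rw [abs_mul, abs_of_pos h0]
  constructor
  · rintro ⟨h1, h2, h3, h4, h5⟩
    exact ⟨h1, ⟨h2, h3, h4⟩, (h h2).trans_le h5⟩
  · rintro ⟨h1, ⟨h2, h3, h4⟩, h5⟩
    exact ⟨h1, h2, h3, h4, (h h2).symm.trans_le h5⟩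

/-- The set of classes of points of the orbit of height at most `s`. -/
noncomputable def orbitClasses (α : ℝ) (a : ℚ) (G : Subgroup SL2Z) (q : ℕ) (s : ℝ) :
    Set (AddCircle (q : ℝ)) :=
  (fun x : ℝ => (x : AddCircle (q : ℝ))) ''
    {x : ℝ | ∃ g ∈ G, (x = mobius g α ∨ x = mobius g ((a : ℝ) - α)) ∧
      2 / |mobius g α - mobius g ((a : ℝ) - α)| ≤ s}

lemma mem_orbitClasses (hα : Irrational α) {s : ℝ} {c : AddCircle (q : ℝ)} :
    c ∈ orbitClasses α a G q s ↔ ∃ k ∈ G, ∃ e, transClass α a q k e = c ∧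
      |linForm α (firstCol k) * linForm (a - α) (firstCol k)| ≤ s * |α - (a - α)| / 2 := by
  constructor
  · rintro ⟨_, ⟨g, hg, rfl | rfl, hs⟩, rfl⟩
    · exact ⟨g⁻¹, G.inv_mem hg, false, by rw [transClass, inv_inv]; rfl,
        (two_div_le_iff hα g s).1 hs⟩
    · exact ⟨g⁻¹, G.inv_mem hg, true, by rw [transClass, inv_inv]; rfl,
        (two_div_le_iff hα g s).1 hs⟩
  · rintro ⟨k, hk, e, rfl, hs⟩
    refine ⟨_, ⟨k⁻¹, G.inv_mem hk, ?_, (two_div_le_iff hα k⁻¹ s).2 (by rwa [inv_inv])⟩, rfl⟩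
    cases e
    · exact Or.inl rfl
    · exact Or.inr rfl

lemma two_mul_ncard_orbitPoints (hα : Irrational α) (hq : α ^ 2 = (a : ℝ) * α + b)
    (hneg : (-1 : SL2Z) ∈ G) (hq0 : 0 < q) (hqG : transMat (q : ℤ) ∈ G)
    (hqmin : ∀ q' : ℕ, 0 < q' → transMat (q' : ℤ) ∈ G → q ≤ q')
    {g₀ : SL2Z} (hg₀ : g₀ ∈ G) (hfix : mobius g₀ α = α)
    {t : ℝ} (ht : ((g₀.1 0 0 + g₀.1 1 1 : ℤ) : ℝ) = t) (ht2 : 2 < |t|) (s : ℝ) :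
    2 * (orbitPoints G α (a - α) (eigenvalueOfTrace t) (s * |α - (a - α)| / 2)).ncard =
      (orbitClasses α a G q s).ncard *
        Nat.card (Quot (fun g g' : {g : SL2Z // g ∈ G ∧ StabPair α a g} =>
          ∃ k : ℤ, (g' : SL2Z) = (g : SL2Z) * g₀ ^ k ∨
            (g' : SL2Z) = -((g : SL2Z) * g₀ ^ k))) := by
  classical
  set n := Nat.card (Quot (fun g g' : {g : SL2Z // g ∈ G ∧ StabPair α a g} =>
          ∃ k : ℤ, (g' : SL2Z) = (g : SL2Z) * g₀ ^ k ∨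
            (g' : SL2Z) = -((g : SL2Z) * g₀ ^ k))) with hn
  set l := eigenvalueOfTrace t
  set X := s * |α - (a - α)| / 2
  set S := orbitPoints G α (a - α) l X
  have hSfin : S.Finite := finite_sectorPoints (ne_conj hα a) _ _ _
  have hrep : ∀ u ∈ S, ∃ k ∈ G, firstCol k = u := fun u hu => (mem_orbitPoints.1 hu).1
  choose! rep hrepG hrep using hrep
  let F : Finset ((Fin 2 → ℤ) × Bool) := hSfin.toFinset ×ˢ Finset.univ
  have hF {p : (Fin 2 → ℤ) × Bool} : p ∈ F ↔ p.1 ∈ S := by simp [F]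
  let cls : (Fin 2 → ℤ) × Bool → AddCircle (q : ℝ) := fun p => transClass α a q (rep p.1) p.2
  have hFcard : F.card = 2 * S.ncard := by
    rw [Finset.card_product, Finset.card_univ, Fintype.card_bool, mul_comm,
      Set.ncard_eq_toFinset_card _ hSfin]
  have hmove {k h : SL2Z} (hk : k ∈ G) (hh : h ∈ G) (hst : StabPair α a h)
      (hsec : InSector α (a - α) l (h • firstCol k))
      (hle : |linForm α (firstCol k) * linForm (a - α) (firstCol k)| ≤ X) {e e' : Bool}
      (hm : mobius h (conjPt α a e) = conjPt α a e') :
      (h • firstCol k, e') ∈ F ∧ cls (h • firstCol k, e') = transClass α a q k e := by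
    have hmem : h • firstCol k ∈ S := mem_orbitPoints.2
      ⟨⟨h * k, G.mul_mem hh hk, firstCol_mul h k⟩, hsec, by rwa [hst.abs_linForm_mul hα]⟩
    exact ⟨hF.2 hmem, (transClass_eq hα hq0 hqG hqmin hh hk (hrepG _ hmem)
      (hrep _ hmem).symm hm).symm⟩
  have himage : ((F.image cls : Finset _) : Set (AddCircle (q : ℝ))) = orbitClasses α a G q s := by
    ext c
    rw [Finset.coe_image, mem_orbitClasses hα]
    constructor
    · rintro ⟨p, hp, rfl⟩
      have hp := hF.1 hp
      refine ⟨rep p.1, hrepG _ hp, p.2, rfl, ?_⟩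
      rw [hrep _ hp]
      exact (mem_orbitPoints.1 hp).2.2
    · rintro ⟨k, hk, e, rfl, hle⟩
      obtain ⟨h, hh, hsec⟩ := exists_inSector hα hq hfix ht ht2 k
      have hm : mobius h (conjPt α a e) = conjPt α a e := by
        refine mobius_of_mem_signedZPowers hh (irrational_conjPt hα e) ?_
        cases e
        · exact hfix
        · exact mobius_conj_of_fix hα hq hfix
      exact ⟨_, hmove hk (signedZPowers_le hneg hg₀ hh) (stabPair_of_eq hα hq hm) hsec hle hm⟩
  have hfiber : ∀ c ∈ F.image cls, (F.filter fun p => cls p = c).card = n := by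
    intro c hc
    rw [← Finset.mem_coe, himage, mem_orbitClasses hα] at hc
    obtain ⟨k, hk, e, rfl, hle⟩ := hc
    rw [hn, card_stab_quot hα hq hneg hg₀ hfix ht ht2 k, ← Set.ncard_coe_finset]
    have hex : ∀ p ∈ (↑(F.filter fun p => cls p = transClass α a q k e) :
        Set ((Fin 2 → ℤ) × Bool)),
        ∃ h ∈ G, StabPair α a h ∧ h • firstCol k = p.1 ∧
          mobius h (conjPt α a e) = conjPt α a p.2 := by
      intro p hp
      obtain ⟨hp, hc⟩ := Finset.mem_filter.1 hp
      have hp := hF.1 hp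
      obtain ⟨h, h1, h2, h3, h4⟩ := exists_of_transClass_eq hα hq hqG hk (hrepG _ hp) hc.symm
      exact ⟨h, h1, h2, h3.trans (hrep _ hp), h4⟩
    choose! H hG hst hcol hmob using hex
    refine Set.ncard_congr (fun p _ => H p) ?_ ?_ ?_
    · intro p hp
      refine ⟨⟨hG p hp, hst p hp⟩, ?_⟩
      rw [hcol p hp]
      exact (mem_orbitPoints.1 (hF.1 (Finset.mem_filter.1 hp).1)).2.1
    · intro p p' hp hp' hpp
      refine Prod.ext ?_ (conjPt_injective hα (a := a) ?_)
      · rw [← hcol p hp, ← hcol p' hp', hpp]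
      · rw [← hmob p hp, ← hmob p' hp', hpp]
    · rintro h ⟨⟨hhG, hhst⟩, hsec⟩
      obtain ⟨e', he'⟩ := hhst.exists_image e
      obtain ⟨m1, m2⟩ := hmove hk hhG hhst hsec hle he'
      have hp : (h • firstCol k, e') ∈ (↑(F.filter fun p => cls p = transClass α a q k e) :
          Set ((Fin 2 → ℤ) × Bool)) := Finset.mem_coe.2 (Finset.mem_filter.2 ⟨m1, m2⟩)
      exact ⟨_, hp, eq_of_smul_firstCol_eq (irrational_conjPt hα e) (hcol _ hp)
        ((hmob _ hp).trans he'.symm)⟩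
  rw [← hFcard, ← himage, Set.ncard_coe_finset, Finset.card_eq_sum_card_image cls F,
    Finset.sum_const_nat hfiber]

lemma isEquivalent_ncard_orbitClasses (hα : Irrational α) (hq : α ^ 2 = (a : ℝ) * α + b)
    (hneg : (-1 : SL2Z) ∈ G) (hfin : G.index ≠ 0) (hq0 : 0 < q) (hqG : transMat (q : ℤ) ∈ G)
    (hqmin : ∀ q' : ℕ, 0 < q' → transMat (q' : ℤ) ∈ G → q ≤ q')
    {g₀ : SL2Z} (hg₀ : g₀ ∈ G) (hfix : mobius g₀ α = α)
    {t : ℝ} (ht : ((g₀.1 0 0 + g₀.1 1 1 : ℤ) : ℝ) = t) (ht2 : 2 < |t|) {n : ℕ}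
    (hn : n = Nat.card (Quot (fun g g' : {g : SL2Z // g ∈ G ∧ StabPair α a g} =>
          ∃ k : ℤ, (g' : SL2Z) = (g : SL2Z) * g₀ ^ k ∨
            (g' : SL2Z) = -((g : SL2Z) * g₀ ^ k)))) :
    Asymptotics.IsEquivalent atTop (fun s : ℝ => ((orbitClasses α a G q s).ncard : ℝ))
      (fun s : ℝ => 12 * (q : ℝ) / (Real.pi ^ 2 * (G.index : ℝ) * (n : ℝ)) *
        Real.log (eigenvalueOfTrace t) * s) := by
  have hl := eigenvalueOfTrace_gt_one ht2
  set l := eigenvalueOfTrace t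
  set d := |α - (a - α)| with hd_def
  have hd : 0 < d := abs_pos.2 (sub_ne_zero.2 (ne_conj hα a))
  have hlog : 0 < Real.log l := Real.log_pos hl
  have hidx : (0 : ℝ) < G.index := by exact_mod_cast Nat.pos_of_ne_zero hfin
  have hqpos : (0 : ℝ) < q := by exact_mod_cast hq0
  have hpi := Real.pi_pos
  have hcount (s : ℝ) : 2 * ((orbitPoints G α (a - α) l (s * d / 2)).ncard : ℝ) =
      (orbitClasses α a G q s).ncard * n := by
    rw [hn]
    exact_mod_cast two_mul_ncard_orbitPoints hα hq hneg hq0 hqG hqmin hg₀ hfix ht ht2 s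
  have hX := tendsto_ncard_sectorPoints (Q := cosetCols ((1 : SL2Z) : SL2Z ⧸ G)) (ne_conj hα a)
    (c := 6 * q / (Real.pi ^ 2 * G.index)) (by positivity)
    (fun φ hc hφ => tendsto_latticeAvg_cosetCols G hfin hq0 hqG hqmin hc hφ) hl
  have hlin : Tendsto (fun s : ℝ => s * d / 2) atTop atTop := by
    simp_rw [mul_div_assoc]
    exact tendsto_id.atTop_mul_const (by positivity)
  have hN : Tendsto (fun s : ℝ => ((orbitClasses α a G q s).ncard : ℝ) * n / s) atTop
      (𝓝 (12 * q / (Real.pi ^ 2 * G.index) * Real.log l)) := by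
    have h := (hX.comp hlin).mul_const d
    have e : 6 * q / (Real.pi ^ 2 * G.index) * (2 * Real.log l / d) * d =
        12 * q / (Real.pi ^ 2 * G.index) * Real.log l := by
      field_simp
      ring
    rw [← hd_def, e] at h
    refine h.congr' ?_
    filter_upwards [eventually_gt_atTop 0] with s hs
    rw [← hcount, Function.comp_apply, orbitPoints]
    field_simp
  have hpos : 0 < 12 * q / (Real.pi ^ 2 * G.index) * Real.log l := by positivity
  have hn0 : (n : ℝ) ≠ 0 := by
    intro h0
    refine hpos.ne (tendsto_nhds_unique ?_ hN)
    simp [h0]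
  rw [Asymptotics.isEquivalent_iff_tendsto_one]
  · have h := hN.div_const (12 * q / (Real.pi ^ 2 * G.index) * Real.log l)
    rw [div_self hpos.ne'] at h
    refine h.congr' ?_
    filter_upwards [eventually_gt_atTop 0] with s hs
    simp only [Pi.div_apply]
    field_simp
  · filter_upwards [eventually_gt_atTop 0] with s hs
    positivity

end Counting

end Equidistribution

/-- Theorem 4.2 of the paper. A finite-index subgroup `G` of `Γ = PSL₂(ℤ)` is encoded as a
subgroup `G` of `SL₂(ℤ)` containing `-1` (so that `[Γ : G]ₚₛₗ = G.index`). Let `α₀` be a real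
quadratic irrational (`α₀` irrational with `α₀² = a α₀ + b`, `a, b ∈ ℚ`, so that
`α₀^σ = a - α₀`), let `q = q_G > 0` be the smallest positive integer with `(z ↦ z + q) ∈ G`,
let `γ₀` be a non-trivial element of `G` fixing `α₀` (necessarily hyperbolic, `|tr γ₀| > 2`),
and let `n₀` be the index of `⟨γ₀⟩` in the stabilizer of `{α₀, α₀^σ}` in `G` (computed in
`PSL₂(ℤ)`, i.e. the number of classes of the stabilizer modulo `γ₀^ℤ·{±1}`). Then, as
`s → +∞`, the number of classes modulo translation by `q_G ℤ` of elements `α` of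
`G·{α₀, α₀^σ}` with `h(α) = 2/|α - α^σ| ≤ s` is asymptotically equivalent to
`(12 q_G / (π² [Γ:G] n₀)) · log((|tr γ₀| + √(tr² γ₀ - 4))/2) · s`. -/
theorem stmt10 (α₀ : ℝ) (hα₀ : Irrational α₀) (a b : ℚ)
    (hquad : α₀ ^ 2 = (a : ℝ) * α₀ + (b : ℝ))
    (G : Subgroup SL2Z) (hGneg : (-1 : SL2Z) ∈ G) (hGfin : G.index ≠ 0)
    (q : ℕ) (hq0 : 0 < q) (hqG : transMat (q : ℤ) ∈ G)
    (hqmin : ∀ q' : ℕ, 0 < q' → transMat (q' : ℤ) ∈ G → q ≤ q')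
    (g₀ : SL2Z) (hg₀G : g₀ ∈ G) (hg₀ne : g₀ ≠ 1 ∧ g₀ ≠ -1)
    (hg₀fix : mobius g₀ α₀ = α₀)
    (htr : 2 < |g₀.1 0 0 + g₀.1 1 1|)
    (n₀ : ℕ)
    (hn₀ : n₀ = Nat.card (Quot (fun g g' :
        {g : SL2Z // g ∈ G ∧
          ((mobius g α₀ = α₀ ∧ mobius g ((a : ℝ) - α₀) = (a : ℝ) - α₀) ∨
           (mobius g α₀ = (a : ℝ) - α₀ ∧ mobius g ((a : ℝ) - α₀) = α₀))} =>
        ∃ k : ℤ, (g' : SL2Z) = (g : SL2Z) * g₀ ^ k ∨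
          (g' : SL2Z) = -((g : SL2Z) * g₀ ^ k)))) :
    Asymptotics.IsEquivalent Filter.atTop
      (fun s : ℝ => (Set.ncard
        ((fun α : ℝ => (α : AddCircle ((q : ℝ)))) ''
          {α : ℝ | ∃ g ∈ G, (α = mobius g α₀ ∨ α = mobius g ((a : ℝ) - α₀)) ∧
            2 / |mobius g α₀ - mobius g ((a : ℝ) - α₀)| ≤ s}) : ℝ))
      (fun s : ℝ =>
        12 * (q : ℝ) / (π ^ 2 * (G.index : ℝ) * (n₀ : ℝ)) *
          Real.log ((|((g₀.1 0 0 + g₀.1 1 1 : ℤ) : ℝ)| +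
            Real.sqrt (((g₀.1 0 0 + g₀.1 1 1 : ℤ) : ℝ) ^ 2 - 4)) / 2) * s) := by
  exact isEquivalent_ncard_orbitClasses hα₀ hquad hGneg hGfin hq0 hqG hqmin hg₀G hg₀fix rfl
    (by exact_mod_cast htr) hn₀
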